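/- Let k be a field, Γ a finite simple graph on {1,…,n} with clique complex K, d ≥ 0, and suppose the Cartan complex (k⟨K⟩ ⊗_k S, ω) of K has vanishing cohomology H^p = 0 for all p ≠ d+1 (this holds if and only if K is Cohen–Macaulay of dimension d); set F_K = H^{d+1}(k⟨K⟩ ⊗_k S, ω), an S-module. Let f : [n] → [m] be a surjective function and regard the Laurent polynomial ring k[ℤ^m] = k[y_1^{±1},…,y_m^{±1}] as an S-module via t_i ↦ y_{f(i)} − 1. Then for every q ≥ 0 there is an isomorphism of S-modules H_q(G_Γ; k[ℤ^m]) ≅ Ext_S^{d+1−q}(F_K, k[ℤ^m]), where the left side is group homology of G_Γ with coefficients in k[ℤ^m] with v_i acting as multiplication by y_{f(i)}. -/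

import Mathlib

attribute [local instance] Classical.propDecidable

noncomputable section

open CategoryTheory

/-! ### Right-angled Artin groups -/

/-- The defining relators of a right-angled Artin group. -/
def raagRels {n : ℕ} (G : SimpleGraph (Fin n)) : Set (FreeGroup (Fin n)) :=
  {r | ∃ i j : Fin n, G.Adj i j ∧
    r = FreeGroup.of i * FreeGroup.of j * (FreeGroup.of i)⁻¹ * (FreeGroup.of j)⁻¹}

/-- The right-angled Artin group of a finite simple graph on `Fin n`. -/
abbrev RAAG {n : ℕ} (G : SimpleGraph (Fin n)) : Type :=
  PresentedGroup (raagRels G)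

/-- The clique complex of a graph. -/
def cliqueComplex {n : ℕ} (Γ : SimpleGraph (Fin n)) : Set (Finset (Fin n)) :=
  {σ | ∀ i ∈ σ, ∀ j ∈ σ, i ≠ j → Γ.Adj i j}

/-! ### Group homology with coefficients in `k[ℤᵐ]` -/

/-- The group algebra `k[ℤᵐ]` of Laurent polynomials. -/
abbrev LaurentRing (k : Type) [CommRing k] (m : ℕ) : Type :=
  AddMonoidAlgebra k (Fin m → ℤ)

/-- Multiplication by the monomial `y^v` on the Laurent ring. -/
def yMul (k : Type) [CommRing k] (m : ℕ) (v : Fin m → ℤ) :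
    LaurentRing k m →ₗ[LaurentRing k m] LaurentRing k m :=
  LinearMap.mulLeft (LaurentRing k m) (AddMonoidAlgebra.single v 1)

/-- The space of inhomogeneous `q`-chains of `G` with coefficients in the
Laurent ring. -/
abbrev inhomogChains (k : Type) [CommRing k] (m : ℕ) (G : Type) (q : ℕ) : Type :=
  (Fin q → G) →₀ LaurentRing k m

variable (k : Type) [Field k] {m : ℕ} {G : Type} [Group G]
  (φ : G →* Multiplicative (Fin m → ℤ))

/-- The differential of the inhomogeneous chain complex computing group
homology, where `g ∈ G` acts on the Laurent ring by multiplication by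
`y^{φ g}`. -/
def inhomogD (q : ℕ) :
    inhomogChains k m G (q + 1) →ₗ[LaurentRing k m] inhomogChains k m G q :=
  Finsupp.lsum ℕ fun g : Fin (q + 1) → G =>
    (Finsupp.lsingle (fun i => g i.succ)).comp
        (yMul k m (-(Multiplicative.toAdd (φ (g 0))))) +
    ∑ j : Fin (q + 1),
      ((-1 : ℤ) ^ ((j : ℕ) + 1)) • Finsupp.lsingle (Fin.contractNth j (· * ·) g)

/-- The differential entering degree `q` (zero for `q = 0`). -/
def inhomogDpre : ∀ q : ℕ,
    inhomogChains k m G q →ₗ[LaurentRing k m] inhomogChains k m G (q - 1)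
  | 0 => 0
  | (q + 1) => inhomogD k φ q

/-- The group homology `H_q(G; k[ℤᵐ])`. -/
def groupHomologyLaurent (q : ℕ) : Type :=
  ↥(Submodule.map (LinearMap.range (inhomogD k φ q)).mkQ
      (LinearMap.ker (inhomogDpre k φ q)))

instance (q : ℕ) : AddCommGroup (groupHomologyLaurent k φ q) :=
  inferInstanceAs (AddCommGroup ↥(Submodule.map _ _))

instance (q : ℕ) : Module (LaurentRing k m) (groupHomologyLaurent k φ q) :=
  inferInstanceAs (Module _ ↥(Submodule.map _ _))

/-! ### The polynomial ring `S` and the Cartan complex -/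

/-- The polynomial ring `S = k[t₁,…,tₙ]`. -/
abbrev polyRing (k : Type) [Field k] (n : ℕ) : Type := MvPolynomial (Fin n) k

/-- The ring homomorphism `S → k[ℤᵐ]`, `tᵢ ↦ y_{f i} - 1`. -/
def phiS (k : Type) [Field k] {n m : ℕ} (f : Fin n → Fin m) :
    polyRing k n →+* LaurentRing k m :=
  (MvPolynomial.eval₂Hom (algebraMap k (LaurentRing k m))
    (fun i => AddMonoidAlgebra.single (Pi.single (f i) 1) 1 - 1))

variable {n : ℕ} (K : Set (Finset (Fin n)))

/-- The degree-`p` term `k⟨K⟩_p ⊗_k S` of the Cartan complex: the free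
`S`-module on the faces of `K` of cardinality `p`. -/
abbrev cartanTerm (p : ℕ) : Type :=
  {I : Finset (Fin n) // I ∈ K ∧ I.card = p} → polyRing k n

/-- The Cartan differential, left multiplication by `ω = ∑ eᵢ ⊗ tᵢ`:
`δ ε_I = ∑_{i ∉ I, I ∪ {i} ∈ K} (-1)^{σ(I,i)} tᵢ ε_{I ∪ {i}}`. -/
def cartanD (p : ℕ) : cartanTerm k K p →ₗ[polyRing k n] cartanTerm k K (p + 1) :=
  LinearMap.pi fun J => ∑ i : Fin n,
    if h : i ∈ J.1 ∧ J.1.erase i ∈ K then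
      ((-1 : ℤ) ^ (J.1.filter (· < i)).card) •
        ((LinearMap.mulLeft (polyRing k n) (MvPolynomial.X i)).comp
          (LinearMap.proj
            (⟨J.1.erase i, h.2, by
                rw [Finset.card_erase_of_mem h.1, J.2.2, Nat.add_sub_cancel]⟩ :
              {I : Finset (Fin n) // I ∈ K ∧ I.card = p})))
    else 0

/-- The Cartan differential entering degree `p` (zero for `p = 0`). -/
def cartanDpre : ∀ p : ℕ, cartanTerm k K (p - 1) →ₗ[polyRing k n] cartanTerm k K p
  | 0 => 0
  | (p + 1) => cartanD k K p

/-- The `p`-th cohomology of the Cartan complex `(k⟨K⟩ ⊗_k S, ω)`. -/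
def cartanCohomology (p : ℕ) : Type :=
  ↥(Submodule.map (LinearMap.range (cartanDpre k K p)).mkQ
      (LinearMap.ker (cartanD k K p)))

instance (p : ℕ) : AddCommGroup (cartanCohomology k K p) :=
  inferInstanceAs (AddCommGroup ↥(Submodule.map _ _))

instance (p : ℕ) : Module (polyRing k n) (cartanCohomology k K p) :=
  inferInstanceAs (Module _ ↥(Submodule.map _ _))

/-- Group homology `H_q(G; k[ℤᵐ])`, regarded as an `S`-module via
`tᵢ ↦ y_{f i} - 1`. -/
def groupHomologyS {n : ℕ} (f : Fin n → Fin m) (q : ℕ) : Type :=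
  groupHomologyLaurent k φ q

instance {n : ℕ} (f : Fin n → Fin m) (q : ℕ) :
    AddCommGroup (groupHomologyS k φ f q) :=
  inferInstanceAs (AddCommGroup (groupHomologyLaurent k φ q))

instance {n : ℕ} (f : Fin n → Fin m) (q : ℕ) :
    Module (polyRing k n) (groupHomologyS k φ f q) :=
  Module.compHom (groupHomologyLaurent k φ q) (phiS k f)

/-- The `S`-module `k[ℤᵐ]` (restriction of scalars along `tᵢ ↦ y_{f i} - 1`),
as an object of the category of `S`-modules. -/
def laurentAsSModule (k : Type) [Field k] {n m : ℕ} (f : Fin n → Fin m) :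
    ModuleCat (polyRing k n) :=
  (ModuleCat.restrictScalars (phiS k f)).obj
    (ModuleCat.of (LaurentRing k m) (LaurentRing k m))

/-! ### Koszul-type boundary operators on functions on finite sets -/

/-- The sign of inserting `i` into `τ`. -/
def insertSign {n : ℕ} (τ : Finset (Fin n)) (i : Fin n) : ℤ :=
  (-1) ^ (τ.filter (· < i)).card

lemma insertSign_mul_insertSign {n : ℕ} {τ : Finset (Fin n)} {i j : Fin n} (hij : i ≠ j)
    (hi : i ∉ τ) (hj : j ∉ τ) :
    insertSign τ i * insertSign (insert i τ) j =
      -(insertSign τ j * insertSign (insert j τ) i) := by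
  wlog h : i < j generalizing i j
  · rw [this hij.symm hj hi (lt_of_le_of_ne (not_lt.1 h) hij.symm), neg_neg]
  · simp only [insertSign, Finset.filter_insert, if_pos h, if_neg h.not_gt]
    rw [Finset.card_insert_of_notMem (by simp [hi])]
    ring

lemma insertSign_insert_of_lt {n : ℕ} {τ : Finset (Fin n)} {i v : Fin n} (h : i < v) :
    insertSign (insert v τ) i = insertSign τ i := by
  simp [insertSign, Finset.filter_insert, h.not_gt]

/-- The Koszul-type boundary `(∂ z)(τ) = ∑_{i ∉ τ} ± z(τ ∪ {i}) aᵢ`. -/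
def koszul {n : ℕ} {A : Type*} [Ring A] (a : Fin n → A) :
    (Finset (Fin n) → A) →ₗ[A] (Finset (Fin n) → A) where
  toFun z τ := ∑ i, if i ∉ τ then insertSign τ i • (z (insert i τ) * a i) else 0
  map_add' y z := by
    ext τ
    simp only [Pi.add_apply, ← Finset.sum_add_distrib]
    refine Finset.sum_congr rfl fun i _ => ?_
    split_ifs <;> simp [add_mul]
  map_smul' c z := by
    ext τ
    simp only [Pi.smul_apply, Finset.smul_sum, RingHom.id_apply]
    refine Finset.sum_congr rfl fun i _ => ?_
    split_ifs <;> simp [mul_assoc, -zsmul_eq_mul]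

lemma koszul_apply {n : ℕ} {A : Type*} [Ring A] (a : Fin n → A) (z : Finset (Fin n) → A)
    (τ : Finset (Fin n)) :
    koszul a z τ = ∑ i, if i ∉ τ then insertSign τ i • (z (insert i τ) * a i) else 0 :=
  rfl

lemma koszul_koszul {n : ℕ} {A : Type*} [Ring A] (a : Fin n → A) (z : Finset (Fin n) → A)
    (hz : ∀ σ, z σ ≠ 0 → ∀ i ∈ σ, ∀ j ∈ σ, Commute (a i) (a j)) :
    koszul a (koszul a z) = 0 := by
  ext τ
  let g : Fin n × Fin n → A := fun p =>
    if p.1 ∉ τ ∧ p.2 ∉ τ ∧ p.1 ≠ p.2 then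
      (insertSign τ p.1 * insertSign (insert p.1 τ) p.2) •
        (z (insert p.2 (insert p.1 τ)) * a p.2 * a p.1) else 0
  have h1 : koszul a (koszul a z) τ = ∑ p : Fin n × Fin n, g p := by
    rw [koszul_apply, Fintype.sum_prod_type]
    refine Finset.sum_congr rfl fun i _ => ?_
    by_cases hi : i ∉ τ
    · rw [if_pos hi, koszul_apply, Finset.sum_mul, Finset.smul_sum]
      refine Finset.sum_congr rfl fun j _ => ?_
      by_cases hj : j ∉ insert i τ
      · have := Finset.mem_insert.not.1 hj
        push Not at this
        simp only [g]
        rw [if_pos hj, if_pos ⟨hi, this.2, this.1.symm⟩, mul_smul, smul_mul_assoc]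
      · rw [if_neg hj]
        simp only [g]
        rw [if_neg]
        · simp
        · rintro ⟨-, h2, h3⟩
          exact hj (by simp [h2, h3.symm])
    · rw [if_neg hi]
      simp [g, hi]
  rw [h1, Pi.zero_apply]
  refine Finset.sum_involution (fun p _ => p.swap) ?_ ?_ (by simp) (by simp)
  · rintro ⟨i, j⟩ -
    by_cases h : i ∉ τ ∧ j ∉ τ ∧ i ≠ j
    · have h' : j ∉ τ ∧ i ∉ τ ∧ j ≠ i := ⟨h.2.1, h.1, h.2.2.symm⟩
      simp only [g, Prod.swap]
      rw [if_pos h, if_pos h', insertSign_mul_insertSign h.2.2 h.1 h.2.1, Finset.insert_comm j i,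
        neg_smul, neg_add_eq_zero]
      congr 1
      by_cases hzz : z (insert i (insert j τ)) = 0
      · simp [hzz]
      · rw [mul_assoc, mul_assoc, (hz _ hzz i (by simp) j (by simp)).eq]
    · have h' : ¬ (j ∉ τ ∧ i ∉ τ ∧ j ≠ i) := fun h' => h ⟨h'.2.1, h'.1, h'.2.2.symm⟩
      simp only [g, Prod.swap]
      rw [if_neg h, if_neg h', add_zero]
  · rintro ⟨i, j⟩ - hne heq
    have : i = j := (congrArg Prod.snd heq)
    exact hne (by simp [g, this])

/-! ### The augmentation-type left ideals of the group algebra of a right-angled Artin group -/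

/-- The element `vᵢ - 1` of the group algebra of a right-angled Artin group. -/
def raagDiff (R : Type) [CommRing R] {n : ℕ} (Γ : SimpleGraph (Fin n)) (i : Fin n) :
    MonoidAlgebra R (RAAG Γ) :=
  MonoidAlgebra.of R (RAAG Γ) (PresentedGroup.of i) - 1

lemma raag_commute {n : ℕ} {Γ : SimpleGraph (Fin n)} {i j : Fin n} (h : Γ.Adj i j) :
    Commute (PresentedGroup.of i : RAAG Γ) (PresentedGroup.of j) := by
  have : (PresentedGroup.mk (raagRels Γ)) (FreeGroup.of i * FreeGroup.of j * (FreeGroup.of i)⁻¹ *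
      (FreeGroup.of j)⁻¹) = 1 :=
    PresentedGroup.one_of_mem ⟨i, j, h, rfl⟩
  simp only [map_mul, map_inv] at this
  exact mul_inv_eq_iff_eq_mul.1 (mul_inv_eq_one.1 this)

lemma raagDiff_commute (R : Type) [CommRing R] {n : ℕ} {Γ : SimpleGraph (Fin n)} {i j : Fin n}
    (h : Γ.Adj i j) : Commute (raagDiff R Γ i) (raagDiff R Γ j) :=
  (((raag_commute h).map (MonoidAlgebra.of R (RAAG Γ))).sub_left (Commute.one_left _)).sub_right
    ((Commute.one_right _).sub_left (Commute.one_left _))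

/-- A homomorphism out of a right-angled Artin group. -/
def raagLift {n : ℕ} {Γ : SimpleGraph (Fin n)} {H : Type} [Group H] (x : Fin n → H)
    (hx : ∀ i j, Γ.Adj i j → Commute (x i) (x j)) : RAAG Γ →* H :=
  PresentedGroup.toGroup (f := x) <| by
    rintro _ ⟨i, j, h, rfl⟩
    simp only [map_mul, map_inv, FreeGroup.lift_apply_of]
    rw [mul_inv_eq_one, mul_inv_eq_iff_eq_mul]
    exact hx i j h

@[simp]
lemma raagLift_of {n : ℕ} {Γ : SimpleGraph (Fin n)} {H : Type} [Group H] (x : Fin n → H)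
    (hx : ∀ i j, Γ.Adj i j → Commute (x i) (x j)) (i : Fin n) :
    raagLift x hx (PresentedGroup.of i) = x i :=
  PresentedGroup.toGroup.of _

/-- The affine permutation `x ↦ u • x + c`. -/
def affinePerm {A M : Type} [Ring A] [AddCommGroup M] [Module A M] (u : Aˣ) (c : M) :
    Equiv.Perm M where
  toFun x := u • x + c
  invFun x := u⁻¹ • (x - c)
  left_inv x := by simp
  right_inv x := by simp

/-- A family of units and vectors satisfying the cocycle condition along the edges of `Γ` gives a
crossed homomorphism. -/
lemma exists_crossedHom {n : ℕ} {Γ : SimpleGraph (Fin n)} {A M : Type} [Ring A] [AddCommGroup M]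
    [Module A M] (u : RAAG Γ →* Aˣ) (c : Fin n → M)
    (hc : ∀ i j, Γ.Adj i j → u (PresentedGroup.of i) • c j + c i =
      u (PresentedGroup.of j) • c i + c j) :
    ∃ D : RAAG Γ → M, (∀ g h, D (g * h) = u g • D h + D g) ∧
      ∀ i, D (PresentedGroup.of i) = c i := by
  let ψ : RAAG Γ →* Equiv.Perm M :=
    raagLift (fun i => affinePerm (u (PresentedGroup.of i)) (c i)) fun i j h => by
      ext x
      have := ((raag_commute h).map u).eq
      change u _ • (u _ • x + c j) + c i = u _ • (u _ • x + c i) + c j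
      rw [smul_add, smul_add, smul_smul, smul_smul, this, add_assoc, add_assoc, hc i j h]
  have key : ∀ g x y, ψ g (x + y) = u g • x + ψ g y := by
    intro g
    have hg : g ∈ Subgroup.closure (Set.range (PresentedGroup.of (rels := raagRels Γ))) := by
      rw [PresentedGroup.closure_range_of]; trivial
    induction hg using Subgroup.closure_induction with
    | mem g hg =>
      obtain ⟨i, rfl⟩ := hg
      intro x y
      simp only [ψ]
      change u _ • (x + y) + c i = _ + (u _ • y + c i)
      rw [smul_add, add_assoc]
    | one => simp
    | mul g h _ _ hg hh =>
      intro x y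
      rw [map_mul, map_mul, Equiv.Perm.mul_apply, Equiv.Perm.mul_apply, hh, hg, mul_smul]
    | inv g _ hg =>
      intro x y
      apply (ψ g).injective
      simp [hg]
  refine ⟨fun g => ψ g 0, fun g h => ?_, fun i => ?_⟩
  · change ψ (g * h) 0 = u g • ψ h 0 + ψ g 0
    rw [map_mul, Equiv.Perm.mul_apply, ← key, add_zero]
  · simp [ψ, affinePerm]

/-- If `b (v - 1)` lies in the left ideal generated by `w - 1`, `w ∈ W`, then `b` lies in the left
ideal generated by those `w - 1` for which `w ∈ W` is adjacent to `v`. -/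
lemma mem_span_of_mul_raagDiff_mem (R : Type) [CommRing R] {n : ℕ} (Γ : SimpleGraph (Fin n))
    (W : Finset (Fin n)) (v : Fin n) (hv : v ∉ W) (b : MonoidAlgebra R (RAAG Γ))
    (hb : b * raagDiff R Γ v ∈ Ideal.span (raagDiff R Γ '' W)) :
    b ∈ Ideal.span (raagDiff R Γ '' ↑(W.filter (Γ.Adj v))) := by
  set I := Ideal.span (raagDiff R Γ '' ↑(W.filter (Γ.Adj v))) with hI
  let M := MonoidAlgebra R (RAAG Γ) ⧸ I
  let q : MonoidAlgebra R (RAAG Γ) →ₗ[MonoidAlgebra R (RAAG Γ)] M := I.mkQ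
  let u : RAAG Γ →* (MonoidAlgebra R (RAAG Γ))ˣ := (MonoidAlgebra.of R (RAAG Γ)).toHomUnits
  have hu : ∀ g, (u g : MonoidAlgebra R (RAAG Γ)) = MonoidAlgebra.of R (RAAG Γ) g := fun g => rfl
  let r : RAAG Γ →* RAAG Γ :=
    raagLift (fun i => if i ∈ insert v W then PresentedGroup.of i else 1) fun i j h => by
      split_ifs
      · exact raag_commute h
      · exact Commute.one_right _
      · exact Commute.one_left _
      · exact Commute.one_left _
  have hr : ∀ i, r (PresentedGroup.of i) = if i ∈ insert v W then PresentedGroup.of i else 1 :=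
    fun i => raagLift_of _ _ i
  have hfix : ∀ j, Γ.Adj v j → u (r (PresentedGroup.of j)) • q 1 = q 1 := by
    intro j hj
    rw [hr]
    split_ifs with hjW
    · rw [Finset.mem_insert, or_iff_right hj.ne'] at hjW
      rw [Units.smul_def, hu, ← map_smul, smul_eq_mul, mul_one]
      refine (Submodule.Quotient.eq _).2 ?_
      exact Ideal.subset_span ⟨j, by simp [hjW, hj], rfl⟩
    · simp
  obtain ⟨D, hD, hDc⟩ := exists_crossedHom (u.comp r) (fun i => if i = v then q 1 else 0) (by
    intro i j h
    simp only [MonoidHom.comp_apply]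
    by_cases hi : i = v
    · subst hi
      rw [if_neg h.ne', if_pos rfl, hfix j h]
      simp
    · by_cases hj : j = v
      · subst hj
        rw [if_neg hi, if_pos rfl, hfix i h.symm]
        simp
      · simp [hi, hj])
  have hDW : ∀ g, ∀ i ∈ insert v W, u (g * PresentedGroup.of i) •
      (u (r (g * PresentedGroup.of i)))⁻¹ • D (g * PresentedGroup.of i) =
      u g • (u (r g))⁻¹ • D g + if i = v then q (MonoidAlgebra.of R _ g) else 0 := by
    intro g i hi
    rw [hD, hDc, map_mul r, hr, if_pos hi, map_mul u, map_mul u, mul_inv_rev, mul_smul, mul_smul,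
      smul_inv_smul, MonoidHom.comp_apply, smul_add, inv_smul_smul, smul_add, add_comm]
    congr 1
    split_ifs
    · rw [Units.smul_def, hu, ← map_smul, smul_eq_mul, mul_one]
    · simp
  let E : MonoidAlgebra R (RAAG Γ) →ₗ[R] M :=
    (Finsupp.lift M R (RAAG Γ) fun g => u g • (u (r g))⁻¹ • D g) ∘ₗ
      (MonoidAlgebra.coeffLinearEquiv R).toLinearMap
  have hE : ∀ g s, E (MonoidAlgebra.single g s) = s • u g • (u (r g))⁻¹ • D g := by
    intro g s
    simp [E]
  have hEW : ∀ i ∈ insert v W, ∀ x, E (x * raagDiff R Γ i) = if i = v then q x else 0 := by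
    intro i hi x
    induction x using MonoidAlgebra.induction_linear with
    | zero => simp
    | add x y hx hy =>
      rw [add_mul, map_add, hx, hy]
      split_ifs <;> simp
    | single g s =>
      rw [raagDiff, mul_sub, mul_one, map_sub, MonoidAlgebra.of_apply,
        MonoidAlgebra.single_mul_single, mul_one, hE, hE, hDW g i hi, smul_add, add_sub_cancel_left]
      split_ifs
      · rw [MonoidAlgebra.of_apply]
        have : (MonoidAlgebra.single g s : MonoidAlgebra R (RAAG Γ)) =
            s • MonoidAlgebra.single g 1 := by simp
        rw [this]
        rfl
      · simp
  have hzero : ∀ y ∈ Ideal.span (raagDiff R Γ '' W), ∀ x, E (x * y) = 0 := by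
    intro y hy
    induction hy using Submodule.span_induction with
    | mem y hy =>
      obtain ⟨i, hi, rfl⟩ := hy
      intro x
      rw [hEW i (Finset.mem_insert_of_mem hi), if_neg]
      rintro rfl
      exact hv hi
    | zero => simp
    | add y z _ _ hy hz => intro x; rw [mul_add, map_add, hy, hz, add_zero]
    | smul c y _ hy => intro x; rw [smul_eq_mul, ← mul_assoc]; exact hy _
  have h1 := hzero _ hb 1
  rw [one_mul, hEW v (Finset.mem_insert_self _ _), if_pos rfl] at h1
  exact (Submodule.Quotient.mk_eq_zero _).1 h1

/-! ### Exactness of the Koszul-type complex over the group algebra -/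

lemma cliqueComplex_mono {n : ℕ} {Γ : SimpleGraph (Fin n)} {σ τ : Finset (Fin n)}
    (hσ : σ ∈ cliqueComplex Γ) (h : τ ⊆ σ) : τ ∈ cliqueComplex Γ :=
  fun i hi j hj => hσ i (h hi) j (h hj)

/-- `z` is supported on the cliques contained in `W`. -/
def CliqueSupported {n : ℕ} {A : Type*} [Zero A] (Γ : SimpleGraph (Fin n)) (W : Finset (Fin n))
    (z : Finset (Fin n) → A) : Prop :=
  ∀ σ, z σ ≠ 0 → σ ∈ cliqueComplex Γ ∧ σ ⊆ W

section CliqueSupported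

variable {n : ℕ} {A : Type*} [Ring A] {Γ : SimpleGraph (Fin n)} {W : Finset (Fin n)}
  {z y : Finset (Fin n) → A}

lemma CliqueSupported.add (hz : CliqueSupported Γ W z) (hy : CliqueSupported Γ W y) :
    CliqueSupported Γ W (z + y) := by
  intro σ h
  by_cases h1 : z σ = 0
  · refine hy σ fun h2 => h ?_
    rw [Pi.add_apply, h1, h2, add_zero]
  · exact hz σ h1

lemma CliqueSupported.neg (hz : CliqueSupported Γ W z) : CliqueSupported Γ W (-z) :=
  fun σ h => hz σ (neg_ne_zero.1 h)

lemma CliqueSupported.mono (hz : CliqueSupported Γ W z) {W' : Finset (Fin n)} (h : W ⊆ W') :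
    CliqueSupported Γ W' z :=
  fun σ hσ => ⟨(hz σ hσ).1, (hz σ hσ).2.trans h⟩

lemma CliqueSupported.map_koszul (a : Fin n → A) (hz : CliqueSupported Γ W z) :
    CliqueSupported Γ W (koszul a z) := by
  intro σ h
  rw [koszul_apply] at h
  obtain ⟨i, -, hi⟩ := Finset.exists_ne_zero_of_sum_ne_zero h
  have : z (insert i σ) ≠ 0 := by
    intro h0
    simp [h0] at hi
  obtain ⟨h1, h2⟩ := hz _ this
  exact ⟨cliqueComplex_mono h1 (Finset.subset_insert _ _), (Finset.subset_insert _ _).trans h2⟩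

lemma CliqueSupported.koszul_koszul_eq_zero (a : Fin n → A)
    (ha : ∀ i j, Γ.Adj i j → Commute (a i) (a j)) (hz : CliqueSupported Γ W z) :
    koszul a (koszul a z) = 0 := by
  refine koszul_koszul a z fun σ hσ i hi j hj => ?_
  by_cases hij : i = j
  · rw [hij]
  · exact ha i j ((hz σ hσ).1 i hi j hj hij)

lemma CliqueSupported.apply_eq_zero (hz : CliqueSupported Γ W z) {σ : Finset (Fin n)} {i : Fin n}
    (hi : i ∈ σ) (hiW : i ∉ W) : z σ = 0 := by
  by_contra h
  exact hiW ((hz σ h).2 hi)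

end CliqueSupported

/-- Cycles of the Koszul-type complex on the cliques in `W` which vanish on the empty clique are
boundaries. -/
lemma koszul_raagDiff_exact (R : Type) [CommRing R] {n : ℕ} (Γ : SimpleGraph (Fin n))
    (W : Finset (Fin n)) (z : Finset (Fin n) → MonoidAlgebra R (RAAG Γ))
    (hz : CliqueSupported Γ W z) (hz0 : z ∅ = 0) (hdz : koszul (raagDiff R Γ) z = 0) :
    ∃ y, CliqueSupported Γ W y ∧ y ∅ = 0 ∧ koszul (raagDiff R Γ) y = z := by
  induction hN : W.card using Nat.strong_induction_on generalizing W z with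
  | _ N ih =>
  have hcomm : ∀ i j, Γ.Adj i j → Commute (raagDiff R Γ i) (raagDiff R Γ j) :=
    fun i j h => raagDiff_commute R h
  rcases W.eq_empty_or_nonempty with rfl | hW
  · refine ⟨0, fun σ h => absurd rfl h, rfl, ?_⟩
    rw [map_zero]
    ext1 σ
    by_contra h
    have := Finset.subset_empty.1 (hz σ (Ne.symm h)).2
    rw [this, hz0] at h
    exact h rfl
  set v := W.max' hW with hv
  have hvW : v ∈ W := W.max'_mem hW
  have hlt : ∀ i ∈ W, i ≠ v → i < v := fun i hi hne => lt_of_le_of_ne (W.le_max' i hi) hne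
  set W' := W.erase v with hW'
  have hvW' : v ∉ W' := Finset.notMem_erase v W
  have hW'W : W' ⊆ W := Finset.erase_subset _ _
  have hcard : W'.card < N := hN ▸ Finset.card_erase_lt_of_mem hvW
  set L := W'.filter (Γ.Adj v) with hL
  have hLW' : L ⊆ W' := Finset.filter_subset _ _
  have hvL : v ∉ L := fun h => hvW' (hLW' h)
  let b : Finset (Fin n) → MonoidAlgebra R (RAAG Γ) := fun τ => if v ∈ τ then 0 else z (insert v τ)
  have hb : CliqueSupported Γ L b := by
    intro τ hτ
    have hvτ : v ∉ τ := fun h => hτ (if_pos h)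
    have hbz : b τ = z (insert v τ) := if_neg hvτ
    rw [hbz] at hτ
    obtain ⟨h1, h2⟩ := hz _ hτ
    refine ⟨cliqueComplex_mono h1 (Finset.subset_insert _ _), fun i hi => ?_⟩
    have hne : i ≠ v := fun h => hvτ (h ▸ hi)
    exact Finset.mem_filter.2 ⟨Finset.mem_erase.2 ⟨hne, h2 (Finset.mem_insert_of_mem hi)⟩,
      h1 v (Finset.mem_insert_self _ _) i (Finset.mem_insert_of_mem hi) hne.symm⟩
  have hdb : koszul (raagDiff R Γ) b = 0 := by
    ext1 τ
    by_cases hvτ : v ∈ τ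
    · exact (hb.map_koszul _).apply_eq_zero hvτ hvL
    · refine Eq.trans ?_ (congrFun hdz (insert v τ))
      rw [koszul_apply, koszul_apply]
      refine Finset.sum_congr rfl fun i _ => ?_
      by_cases hiv : i = v
      · subst hiv
        rw [if_pos hvτ, if_neg (by simp)]
        simp [b]
      · have hbi : b (insert i τ) = z (insert i (insert v τ)) := by
          rw [Finset.insert_comm]
          exact if_neg (by simp [hvτ, Ne.symm hiv])
        have hmem : i ∉ insert v τ ↔ i ∉ τ := by simp [hiv]
        simp only [hmem]
        by_cases h0 : z (insert i (insert v τ)) = 0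
        · rw [hbi, h0]
          simp
        · have hi : i ∈ W := (hz _ h0).2 (Finset.mem_insert_self _ _)
          rw [hbi, insertSign_insert_of_lt (hlt i hi hiv)]
  have hb0 : b ∅ ∈ Ideal.span (raagDiff R Γ '' L) := by
    refine mem_span_of_mul_raagDiff_mem R Γ W' v hvW' _ ?_
    have h := congrFun hdz ∅
    have hsum : ∑ i, z {i} * raagDiff R Γ i = 0 := by
      rw [koszul_apply] at h
      simpa [insertSign] using h
    have hbz : b ∅ = z {v} := by simp [b]
    rw [hbz, ← Finset.add_sum_erase _ _ (Finset.mem_univ v)] at *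
    rw [eq_neg_of_add_eq_zero_left hsum]
    refine neg_mem (Submodule.sum_mem _ fun i hi => ?_)
    by_cases hiW : i ∈ W
    · exact Ideal.mul_mem_left _ _ (Ideal.subset_span
        ⟨i, Finset.mem_erase.2 ⟨(Finset.mem_erase.1 hi).1, hiW⟩, rfl⟩)
    · rw [hz.apply_eq_zero (Finset.mem_singleton_self i) hiW, zero_mul]
      exact Submodule.zero_mem _
  obtain ⟨c', hc'⟩ := (Submodule.mem_span_image_finset_iff_exists_fun _).1 hb0
  obtain ⟨c, hc⟩ : ∃ c : Fin n → MonoidAlgebra R (RAAG Γ),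
      ∑ i ∈ L, c i * raagDiff R Γ i = b ∅ := by
    refine ⟨fun i => if h : i ∈ L then c' ⟨i, h⟩ else 0, ?_⟩
    rw [← hc', ← Finset.sum_coe_sort]
    refine Finset.sum_congr rfl fun i _ => ?_
    simp only [dif_pos i.2, smul_eq_mul]
  let c₁ : Finset (Fin n) → MonoidAlgebra R (RAAG Γ) := fun τ =>
    ∑ i ∈ L, if τ = {i} then c i else 0
  have hc₁s : ∀ i, c₁ {i} = if i ∈ L then c i else 0 := by
    intro i
    simp [c₁]
  have hc₁ : CliqueSupported Γ L c₁ := by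
    intro τ hτ
    obtain ⟨i, hi, h⟩ := Finset.exists_ne_zero_of_sum_ne_zero hτ
    obtain rfl : τ = {i} := by
      by_contra h'
      exact h (if_neg h')
    refine ⟨fun j hj k hk hjk => ?_, by simpa using hi⟩
    exact absurd ((Finset.mem_singleton.1 hj).trans (Finset.mem_singleton.1 hk).symm) hjk
  have hc₁0 : c₁ ∅ = 0 := Finset.sum_eq_zero fun i _ => if_neg (Finset.singleton_ne_empty i).symm
  have hdc₁ : koszul (raagDiff R Γ) c₁ ∅ = b ∅ := by
    rw [← hc, koszul_apply]
    simp [insertSign, hc₁s, ite_mul, Finset.sum_ite_mem]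
  have hLcard : L.card < N := (Finset.card_le_card hLW').trans_lt hcard
  obtain ⟨y₂, hy₂, hy₂0, hdy₂⟩ := ih L.card hLcard L (b + -koszul (raagDiff R Γ) c₁)
    (hb.add (hc₁.map_koszul _).neg) (by simp [hdc₁])
    (by rw [map_add, map_neg, hdb, hc₁.koszul_koszul_eq_zero _ hcomm, neg_zero, add_zero]) rfl
  let y := c₁ + y₂
  have hy : CliqueSupported Γ L y := hc₁.add hy₂
  have hy0 : y ∅ = 0 := by simp [y, hc₁0, hy₂0]
  have hdy : koszul (raagDiff R Γ) y = b := by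
    simp only [y]
    rw [map_add, hdy₂]
    abel
  let Y : Finset (Fin n) → MonoidAlgebra R (RAAG Γ) := fun τ => if v ∈ τ then y (τ.erase v) else 0
  have hY : CliqueSupported Γ W Y := by
    intro τ hτ
    have hvτ : v ∈ τ := by
      by_contra h
      exact hτ (if_neg h)
    rw [show Y τ = y (τ.erase v) from if_pos hvτ] at hτ
    obtain ⟨h1, h2⟩ := hy _ hτ
    have hadj : ∀ i ∈ τ, i ≠ v → Γ.Adj v i := fun i hi hne =>
      (Finset.mem_filter.1 (h2 (Finset.mem_erase.2 ⟨hne, hi⟩))).2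
    refine ⟨fun i hi j hj hij => ?_, fun i hi => ?_⟩
    · by_cases hiv : i = v
      · rw [hiv]
        exact hadj j hj (fun h => hij (hiv.trans h.symm))
      · by_cases hjv : j = v
        · rw [hjv]
          exact (hadj i hi hiv).symm
        · exact h1 i (Finset.mem_erase.2 ⟨hiv, hi⟩) j (Finset.mem_erase.2 ⟨hjv, hj⟩) hij
    · by_cases hiv : i = v
      · rwa [hiv]
      · exact hW'W (hLW' (h2 (Finset.mem_erase.2 ⟨hiv, hi⟩)))
  have hdY₁ : ∀ τ, v ∈ τ → koszul (raagDiff R Γ) Y τ = b (τ.erase v) := by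
    intro τ hvτ
    rw [← hdy, koszul_apply, koszul_apply]
    refine Finset.sum_congr rfl fun i _ => ?_
    by_cases hiv : i = v
    · subst hiv
      rw [if_neg (by simpa using hvτ), hy.apply_eq_zero (Finset.mem_insert_self _ _) hvL]
      simp
    · have hmem : i ∉ τ.erase v ↔ i ∉ τ := by simp [hiv]
      have hYi : Y (insert i τ) = y (insert i (τ.erase v)) := by
        rw [← Finset.erase_insert_of_ne hiv]
        exact if_pos (Finset.mem_insert_of_mem hvτ)
      simp only [hmem, hYi]
      by_cases h0 : y (insert i (τ.erase v)) = 0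
      · rw [h0]
        simp
      · have hi : i ∈ W := hW'W (hLW' ((hy _ h0).2 (Finset.mem_insert_self _ _)))
        rw [← insertSign_insert_of_lt (τ := τ.erase v) (hlt i hi hiv), Finset.insert_erase hvτ]
  have hdY₀ : koszul (raagDiff R Γ) Y ∅ = 0 := by
    rw [koszul_apply]
    refine Finset.sum_eq_zero fun i _ => ?_
    by_cases hiv : i = v
    · subst hiv
      simp [Y, hy0]
    · simp [Y, Ne.symm hiv]
  obtain ⟨y', hy', hy'0, hdy'⟩ := ih W'.card hcard W' (z + -koszul (raagDiff R Γ) Y) (by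
      intro τ hτ
      obtain ⟨h1, h2⟩ := (hz.add (hY.map_koszul (raagDiff R Γ)).neg) τ hτ
      refine ⟨h1, fun i hi => Finset.mem_erase.2 ⟨?_, h2 hi⟩⟩
      rintro rfl
      apply hτ
      rw [Pi.add_apply, Pi.neg_apply, hdY₁ τ hi]
      simp [b, Finset.insert_erase hi])
    (by rw [Pi.add_apply, Pi.neg_apply, hdY₀, hz0]; simp)
    (by rw [map_add, map_neg, hdz, hY.koszul_koszul_eq_zero _ hcomm, neg_zero, add_zero]) rfl
  refine ⟨y' + Y, (hy'.mono hW'W).add hY, by simp [hy'0, Y], ?_⟩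
  rw [map_add, hdy']
  abel

/-! ### Projective resolutions from exact sequences -/

lemma chainComplex_of_d {C : Type*} [Category C] [Abelian C] (X : ℕ → C)
    (d : ∀ n, X (n + 1) ⟶ X n) (sq : ∀ n, d (n + 1) ≫ d n = 0) (n : ℕ) :
    (ChainComplex.of X d sq).d (n + 1) n = d n := by
  simp

/-- The projective resolution given by an exact sequence `⋯ ⟶ X 1 ⟶ X 0 ⟶ Z ⟶ 0`. -/
def projectiveResolutionOfExact {C : Type*} [Category C] [Abelian C] {Z : C} (X : ℕ → C)
    (d : ∀ n, X (n + 1) ⟶ X n) (sq : ∀ n, d (n + 1) ≫ d n = 0) (ε : X 0 ⟶ Z) (hε : d 0 ≫ ε = 0)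
    (hproj : ∀ n, Projective (X n)) (hepi : Epi ε) (h0 : (ShortComplex.mk _ _ hε).Exact)
    (hex : ∀ n, (ShortComplex.mk _ _ (sq n)).Exact) : ProjectiveResolution Z where
  complex := ChainComplex.of X d sq
  projective n := hproj n
  π := (ChainComplex.toSingle₀Equiv _ _).symm
    ⟨ε, (congrArg (· ≫ ε) (chainComplex_of_d X d sq 0)).trans hε⟩
  quasiIso := ⟨fun n => by
    cases n with
    | zero =>
      rw [ChainComplex.quasiIsoAt₀_iff, ShortComplex.quasiIso_iff_of_zeros']
      · refine (ShortComplex.exact_and_epi_g_iff_of_iso ?_).2 ⟨h0, hepi⟩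
        exact ShortComplex.isoMk (Iso.refl _) (Iso.refl _) (Iso.refl _)
          ((Category.id_comp _).trans
            ((chainComplex_of_d X d sq 0).symm.trans (Category.comp_id _).symm))
          ((Category.id_comp _).trans ((Category.comp_id _).trans
            (by exact ChainComplex.toSingle₀Equiv_symm_apply_f_zero (C := .of X d sq) ε _)).symm)
      · rfl
      · rfl
      · rfl
    | succ n =>
      rw [quasiIsoAt_iff_exactAt']
      · rw [HomologicalComplex.exactAt_iff' _ (n + 1 + 1) (n + 1) n (by simp) (by simp)]
        refine (ShortComplex.exact_iff_of_iso ?_).2 (hex n)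
        exact ShortComplex.isoMk (Iso.refl _) (Iso.refl _) (Iso.refl _)
          ((Category.id_comp _).trans
            ((chainComplex_of_d X d sq _).symm.trans (Category.comp_id _).symm))
          ((Category.id_comp _).trans
            ((chainComplex_of_d X d sq _).symm.trans (Category.comp_id _).symm))
      · apply ChainComplex.exactAt_succ_single_obj⟩

/-! ### The graded pieces of the Koszul-type complex on cliques -/

/-- The cliques of `Γ` with `q` vertices. -/
abbrev CliqueOfCard {n : ℕ} (Γ : SimpleGraph (Fin n)) (q : ℕ) : Type :=
  {σ : Finset (Fin n) // σ ∈ cliqueComplex Γ ∧ σ.card = q}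

section CliqueOfCard

variable {n : ℕ} {Γ : SimpleGraph (Fin n)} {A : Type} [Ring A]

/-- The face of a clique obtained by removing the vertex `i`. -/
def CliqueOfCard.erase {q : ℕ} (σ : CliqueOfCard Γ (q + 1)) (i : Fin n) (h : i ∈ σ.1) :
    CliqueOfCard Γ q :=
  ⟨σ.1.erase i, cliqueComplex_mono σ.2.1 (Finset.erase_subset _ _), by
    rw [Finset.card_erase_of_mem h, σ.2.2, Nat.add_sub_cancel]⟩

/-- The boundary of a clique with coefficients `c`. -/
def cliqueBoundary {M : Type} [AddCommGroup M] {q : ℕ} (c : Fin n → M)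
    (σ : CliqueOfCard Γ (q + 1)) : CliqueOfCard Γ q →₀ M :=
  ∑ i, if h : i ∈ σ.1 then Finsupp.single (σ.erase i h) (insertSign (σ.1.erase i) i • c i) else 0

lemma map_cliqueBoundary {M N : Type} [AddCommGroup M] [AddCommGroup N] {q : ℕ} (g : M →+ N)
    (c : Fin n → M) (σ : CliqueOfCard Γ (q + 1)) :
    Finsupp.mapRange.addMonoidHom g (cliqueBoundary c σ) = cliqueBoundary (fun i => g (c i)) σ := by
  simp only [cliqueBoundary, map_sum]
  refine Finset.sum_congr rfl fun i _ => ?_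
  split_ifs <;> simp

/-- A function on the cliques with `q` vertices, extended by zero to all finite sets. -/
def extendClique {q : ℕ} : (CliqueOfCard Γ q →₀ A) →ₗ[A] (Finset (Fin n) → A) :=
  Finsupp.lcoeFun ∘ₗ Finsupp.lmapDomain A A Subtype.val

lemma extendClique_single {q : ℕ} (σ : CliqueOfCard Γ q) (a : A) (τ : Finset (Fin n)) :
    extendClique (Finsupp.single σ a) τ = if τ = σ.1 then a else 0 := by
  simp [extendClique, Finsupp.single_apply, eq_comm]

lemma extendClique_apply {q : ℕ} (z : CliqueOfCard Γ q →₀ A) (σ : CliqueOfCard Γ q) :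
    extendClique z σ.1 = z σ :=
  Finsupp.mapDomain_apply Subtype.val_injective z σ

lemma extendClique_eq_zero {q : ℕ} (z : CliqueOfCard Γ q →₀ A) {σ : Finset (Fin n)}
    (h : ¬ (σ ∈ cliqueComplex Γ ∧ σ.card = q)) : extendClique z σ = 0 :=
  Finsupp.mapDomain_of_notMem_range z σ (by
    rintro ⟨τ, rfl⟩
    exact h τ.2)

lemma extendClique_injective {q : ℕ} :
    Function.Injective (extendClique : (CliqueOfCard Γ q →₀ A) → _) := by
  intro y z h
  ext σ
  rw [← extendClique_apply, h, extendClique_apply]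

/-- The part of a function on finite sets which is supported on the cliques with `q` vertices. -/
def restrictClique (Γ : SimpleGraph (Fin n)) (q : ℕ) (z : Finset (Fin n) → A) :
    CliqueOfCard Γ q →₀ A :=
  Finsupp.equivFunOnFinite.symm fun σ => z σ.1

lemma cliqueSupported_extendClique {q : ℕ} (z : CliqueOfCard Γ q →₀ A) :
    CliqueSupported Γ Finset.univ (extendClique z) := by
  intro σ h
  refine ⟨?_, Finset.subset_univ _⟩
  by_contra h'
  exact h (extendClique_eq_zero z fun h'' => h' h''.1)

/-- The differential of the Koszul-type complex on cliques with coefficients `a`. -/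
def cliqueD (Γ : SimpleGraph (Fin n)) (a : Fin n → A) (q : ℕ) :
    (CliqueOfCard Γ (q + 1) →₀ A) →ₗ[A] (CliqueOfCard Γ q →₀ A) :=
  Finsupp.lsum ℕ fun σ => ∑ i, if h : i ∈ σ.1 then
    insertSign (σ.1.erase i) i •
      (Finsupp.lsingle (σ.erase i h) ∘ₗ LinearMap.toSpanSingleton A A (a i)) else 0

lemma cliqueD_single (a : Fin n → A) (q : ℕ) (σ : CliqueOfCard Γ (q + 1)) (b : A) :
    cliqueD Γ a q (Finsupp.single σ b) = cliqueBoundary (fun i => b * a i) σ := by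
  rw [cliqueD, Finsupp.lsum_single, LinearMap.sum_apply]
  refine Finset.sum_congr rfl fun i _ => ?_
  split_ifs
  · simp only [LinearMap.smul_apply, LinearMap.comp_apply, LinearMap.toSpanSingleton_apply,
      Finsupp.lsingle_apply, Finsupp.smul_single, smul_eq_mul]
  · rfl

lemma extendClique_cliqueD (a : Fin n → A) (q : ℕ) (z : CliqueOfCard Γ (q + 1) →₀ A) :
    extendClique (cliqueD Γ a q z) = koszul a (extendClique z) := by
  induction z using Finsupp.induction_linear with
  | zero => simp
  | add y z hy hz => simp [hy, hz]
  | single σ b =>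
    ext τ
    rw [cliqueD_single, cliqueBoundary, map_sum, Finset.sum_apply, koszul_apply]
    refine Finset.sum_congr rfl fun i _ => ?_
    rw [extendClique_single]
    by_cases h : i ∈ σ.1
    · rw [dif_pos h, extendClique_single]
      by_cases hτ : τ = σ.1.erase i
      · subst hτ
        simp [CliqueOfCard.erase, Finset.insert_erase h]
      · have : ¬ (i ∉ τ ∧ insert i τ = σ.1) := by
          rintro ⟨h1, h2⟩
          rw [← h2, Finset.erase_insert h1] at hτ
          exact hτ rfl
        rw [if_neg (show ¬ τ = (σ.erase i h).1 from hτ)]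
        split_ifs <;> simp_all
    · have : insert i τ ≠ σ.1 := fun h' => h (h' ▸ Finset.mem_insert_self _ _)
      simp [h, this]

lemma cliqueD_cliqueD (a : Fin n → A) (ha : ∀ i j, Γ.Adj i j → Commute (a i) (a j)) (q : ℕ)
    (z : CliqueOfCard Γ (q + 2) →₀ A) : cliqueD Γ a q (cliqueD Γ a (q + 1) z) = 0 := by
  apply extendClique_injective
  rw [extendClique_cliqueD, extendClique_cliqueD,
    (cliqueSupported_extendClique z).koszul_koszul_eq_zero a ha, map_zero]

lemma cliqueD_raagDiff_exact (R : Type) [CommRing R] (q : ℕ)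
    (z : CliqueOfCard Γ (q + 1) →₀ MonoidAlgebra R (RAAG Γ))
    (hz : cliqueD Γ (raagDiff R Γ) q z = 0) : ∃ y, cliqueD Γ (raagDiff R Γ) (q + 1) y = z := by
  obtain ⟨y, hy, -, hdy⟩ := koszul_raagDiff_exact R Γ Finset.univ (extendClique z)
    (cliqueSupported_extendClique z) (extendClique_eq_zero z (by simp))
    (by rw [← extendClique_cliqueD, hz, map_zero])
  refine ⟨restrictClique Γ (q + 2) y, ?_⟩
  ext1 τ
  rw [← extendClique_apply, extendClique_cliqueD, ← extendClique_apply z, ← hdy, koszul_apply,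
    koszul_apply]
  refine Finset.sum_congr rfl fun i _ => ?_
  split_ifs with hi
  · rfl
  · congr 2
    by_cases h : insert i τ.1 ∈ cliqueComplex Γ
    · exact extendClique_apply _ (⟨_, h, by rw [Finset.card_insert_of_notMem hi, τ.2.2]⟩ :
        CliqueOfCard Γ (q + 2))
    · rw [extendClique_eq_zero _ fun h' => h h'.1]
      by_contra h'
      exact h (hy _ (Ne.symm h')).1

end CliqueOfCard

/-! ### The free resolution of the trivial representation of a right-angled Artin group -/

section Resolution

variable (R : Type) [CommRing R] {n : ℕ} (Γ : SimpleGraph (Fin n))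

/-- The differential of the clique resolution. -/
def cliqueRepD (q : ℕ) : Rep.free R (RAAG Γ) (CliqueOfCard Γ (q + 1)) ⟶
    Rep.free R (RAAG Γ) (CliqueOfCard Γ q) :=
  Rep.freeLift R (RAAG Γ) _ (cliqueBoundary (raagDiff R Γ))

lemma free_smul (α : Type) (g : RAAG Γ) (z : α →₀ MonoidAlgebra R (RAAG Γ)) :
    Representation.free R (RAAG Γ) α g z = MonoidAlgebra.single g (1 : R) • z := by
  induction z using Finsupp.induction_linear with
  | zero => simp
  | add y z hy hz => simp [hy, hz]
  | single σ b =>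
    induction b using MonoidAlgebra.induction_linear with
    | zero => simp
    | add y z hy hz => rw [Finsupp.single_add, map_add, hy, hz, smul_add]
    | single h r =>
      rw [Representation.free_single_single, Finsupp.smul_single, smul_eq_mul,
        MonoidAlgebra.single_mul_single, one_mul]

lemma cliqueRepD_apply (q : ℕ) (z : CliqueOfCard Γ (q + 1) →₀ MonoidAlgebra R (RAAG Γ)) :
    (cliqueRepD R Γ q).hom z = cliqueD Γ (raagDiff R Γ) q z := by
  induction z using Finsupp.induction_linear with
  | zero => simp
  | add y z hy hz => rw [map_add, map_add, hy, hz]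
  | single σ b =>
    induction b using MonoidAlgebra.induction_linear with
    | zero => simp
    | add y z hy hz => rw [Finsupp.single_add, map_add, hy, hz, map_add]
    | single h r =>
      rw [cliqueRepD, Rep.freeLift, Rep.hom_ofHom, Representation.freeLift_single_single,
        cliqueD_single, Rep.of_ρ, free_smul]
      refine Eq.trans ?_ (map_cliqueBoundary (AddMonoidHom.mulLeft (MonoidAlgebra.single h r))
        (raagDiff R Γ) σ)
      ext1 τ
      rw [Finsupp.smul_apply, Finsupp.smul_apply, smul_eq_mul, ← smul_mul_assoc,
        MonoidAlgebra.smul_single, smul_eq_mul, mul_one]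
      rfl

lemma cliqueRepD_comp (q : ℕ) : cliqueRepD R Γ (q + 1) ≫ cliqueRepD R Γ q = 0 := by
  refine Rep.free_ext _ _ _ _ _ fun σ => ?_
  change (cliqueRepD R Γ q).hom ((cliqueRepD R Γ (q + 1)).hom _) = 0
  rw [cliqueRepD_apply, cliqueRepD_apply, cliqueD_cliqueD _ fun i j h => raagDiff_commute R h]

/-- The augmentation of the clique resolution. -/
def cliqueAug : Rep.free R (RAAG Γ) (CliqueOfCard Γ 0) ⟶ Rep.trivial R (RAAG Γ) R :=
  Rep.freeLift R (RAAG Γ) _ fun _ => (1 : R)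

lemma rep_exact {G : Type} [Group G] {S : ShortComplex (Rep.{0} R G)}
    (h : ∀ x, S.g.hom x = 0 → ∃ y, S.f.hom y = x) : S.Exact := by
  rw [← ShortComplex.exact_map_iff_of_faithful S (forget₂ (Rep.{0} R G) (ModuleCat.{0} R)),
    ShortComplex.moduleCat_exact_iff]
  exact h

/-- The empty clique. -/
def emptyClique : CliqueOfCard Γ 0 := ⟨∅, fun i hi => absurd hi (Finset.notMem_empty i), rfl⟩

lemma eq_emptyClique (σ : CliqueOfCard Γ 0) : σ = emptyClique Γ :=
  Subtype.ext (Finset.card_eq_zero.1 σ.2.2)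

/-- The clique with a single vertex. -/
def singletonClique (i : Fin n) : CliqueOfCard Γ 1 :=
  ⟨{i}, fun _ hj _ hk hjk =>
    absurd ((Finset.mem_singleton.1 hj).trans (Finset.mem_singleton.1 hk).symm) hjk, rfl⟩

lemma cliqueAug_apply (b : MonoidAlgebra R (RAAG Γ)) :
    (cliqueAug R Γ).hom (Finsupp.single (emptyClique Γ) b) =
      MonoidAlgebra.lift R R (RAAG Γ) 1 b := by
  induction b using MonoidAlgebra.induction_linear with
  | zero => simp
  | add y z hy hz => rw [Finsupp.single_add, map_add, hy, hz, map_add]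
  | single h r =>
    rw [cliqueAug, Rep.freeLift, Rep.hom_ofHom, Representation.freeLift_single_single]
    simp

lemma cliqueD_singletonClique {A : Type} [Ring A] (a : Fin n → A) (i : Fin n) (b : A) :
    cliqueD Γ a 0 (Finsupp.single (singletonClique Γ i) b) =
      Finsupp.single (emptyClique Γ) (b * a i) := by
  rw [cliqueD_single, cliqueBoundary, Finset.sum_eq_single i]
  · rw [dif_pos (show i ∈ (singletonClique Γ i).1 from Finset.mem_singleton_self i),
      eq_emptyClique Γ (CliqueOfCard.erase _ _ _)]
    simp [singletonClique, insertSign]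
  · intro j _ hj
    exact dif_neg fun h => hj (Finset.mem_singleton.1 h)
  · simp

lemma exists_cliqueD_eq_of_sub_one (g : RAAG Γ) :
    ∃ y, cliqueD Γ (raagDiff R Γ) 0 y =
      Finsupp.single (emptyClique Γ) (MonoidAlgebra.of R (RAAG Γ) g - 1) := by
  have hg : g ∈ Subgroup.closure (Set.range (PresentedGroup.of : Fin n → RAAG Γ)) := by
    rw [PresentedGroup.closure_range_of]
    trivial
  induction hg using Subgroup.closure_induction with
  | mem x hx =>
    obtain ⟨i, rfl⟩ := hx
    exact ⟨Finsupp.single (singletonClique Γ i) 1, by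
      rw [cliqueD_singletonClique, one_mul, raagDiff]⟩
  | one => exact ⟨0, by rw [map_zero, map_one, sub_self, Finsupp.single_zero]⟩
  | mul x y _ _ hx hy =>
    obtain ⟨u, hu⟩ := hx
    obtain ⟨v, hv⟩ := hy
    refine ⟨MonoidAlgebra.of R (RAAG Γ) x • v + u, ?_⟩
    rw [map_add, map_smul, hu, hv, Finsupp.smul_single, ← Finsupp.single_add, map_mul, smul_eq_mul]
    congr 1
    noncomm_ring
  | inv x _ hx =>
    obtain ⟨u, hu⟩ := hx
    refine ⟨-(MonoidAlgebra.of R (RAAG Γ) x⁻¹ • u), ?_⟩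
    rw [map_neg, map_smul, hu, Finsupp.smul_single, ← Finsupp.single_neg, smul_eq_mul, mul_sub,
      ← map_mul, inv_mul_cancel, map_one, mul_one, neg_sub]

lemma cliqueRepD_comp_aug : cliqueRepD R Γ 0 ≫ cliqueAug R Γ = 0 := by
  refine Rep.free_ext _ _ _ _ _ fun σ => ?_
  change (cliqueAug R Γ).hom ((cliqueRepD R Γ 0).hom _) = 0
  obtain ⟨i, hi⟩ := Finset.card_eq_one.1 σ.2.2
  obtain rfl : σ = singletonClique Γ i := Subtype.ext hi
  rw [cliqueRepD_apply, cliqueD_singletonClique, cliqueAug_apply]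
  simp [raagDiff]

lemma exists_cliqueD_eq_of_lift_eq_zero (b : MonoidAlgebra R (RAAG Γ))  :
    ∃ y, cliqueD Γ (raagDiff R Γ) 0 y = Finsupp.single (emptyClique Γ)
      (b - algebraMap R _ (MonoidAlgebra.lift R R (RAAG Γ) 1 b)) := by
  induction b using MonoidAlgebra.induction_linear with
  | zero => exact ⟨0, by simp⟩
  | add y z hy hz =>
    obtain ⟨u, hu⟩ := hy
    obtain ⟨v, hv⟩ := hz
    refine ⟨u + v, ?_⟩
    rw [map_add, hu, hv, ← Finsupp.single_add, map_add, map_add]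
    congr 1
    abel
  | single h r =>
    obtain ⟨u, hu⟩ := exists_cliqueD_eq_of_sub_one R Γ h
    refine ⟨algebraMap R (MonoidAlgebra R (RAAG Γ)) r • u, ?_⟩
    rw [map_smul, hu, Finsupp.smul_single]
    congr 1
    simp [mul_sub, MonoidAlgebra.single_mul_single]

lemma cliqueAug_exact : (ShortComplex.mk _ _ (cliqueRepD_comp_aug R Γ)).Exact := by
  refine rep_exact R fun (x : CliqueOfCard Γ 0 →₀ MonoidAlgebra R (RAAG Γ)) hx => ?_
  obtain ⟨b, rfl⟩ : ∃ b, x = Finsupp.single (emptyClique Γ) b :=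
    ⟨x (emptyClique Γ), by
      ext1 σ
      rw [eq_emptyClique Γ σ, Finsupp.single_eq_same]⟩
  obtain ⟨y, hy⟩ := exists_cliqueD_eq_of_lift_eq_zero R Γ b
  rw [← cliqueAug_apply, hx, map_zero, sub_zero] at hy
  exact ⟨y, (cliqueRepD_apply R Γ 0 y).trans hy⟩

/-- The free resolution of the trivial representation of a right-angled Artin group whose basis in
degree `q` are the cliques with `q` vertices. -/
def cliqueResolution : ProjectiveResolution (Rep.trivial R (RAAG Γ) R) :=
  projectiveResolutionOfExact (fun q => Rep.free R (RAAG Γ) (CliqueOfCard Γ q)) (cliqueRepD R Γ)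
    (cliqueRepD_comp R Γ) (cliqueAug R Γ) (cliqueRepD_comp_aug R Γ) (fun q => inferInstance)
    ((Rep.epi_iff_surjective _).2 fun r =>
      ⟨Finsupp.single (emptyClique Γ) (algebraMap R _ r), by
        rw [cliqueAug_apply]
        simp⟩)
    (cliqueAug_exact R Γ) fun q => rep_exact R fun x hx => by
      obtain ⟨y, hy⟩ := cliqueD_raagDiff_exact R q x ((cliqueRepD_apply R Γ q x).symm.trans hx)
      exact ⟨y, (cliqueRepD_apply R Γ (q + 1) y).trans hy⟩

end Resolution

/-! ### Homology as a subquotient -/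

lemma exists_subquotient_addEquiv {R S B B' : Type} [Ring R] [Ring S] [AddCommGroup B] [Module R B]
    [AddCommGroup B'] [Module S B'] (φ : S →+* R) {Z N : Submodule R B} {Z' N' : Submodule S B'}
    (e : B ≃+ B') (he : ∀ s b, e (φ s • b) = s • e b) (hZ : ∀ b, b ∈ Z ↔ e b ∈ Z')
    (hN : ∀ b, b ∈ N ↔ e b ∈ N') :
    ∃ E : ↥(Z.map N.mkQ) ≃+ ↥(Z'.map N'.mkQ), ∀ s x, E (φ s • x) = s • E x := by
  have hN' : N.toAddSubgroup.map (e : B →+ B') = N'.toAddSubgroup := by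
    ext b
    constructor
    · rintro ⟨a, ha, rfl⟩
      exact (hN a).1 ha
    · intro hb
      exact ⟨e.symm b, (hN _).2 (by rwa [e.apply_symm_apply]), e.apply_symm_apply b⟩
  let E₀ : (B ⧸ N) ≃+ (B' ⧸ N') := QuotientAddGroup.congr N.toAddSubgroup N'.toAddSubgroup e hN'
  have hE₀ : ∀ b, E₀ (N.mkQ b) = N'.mkQ (e b) := fun b => rfl
  have hmem : ∀ x, x ∈ Z.map N.mkQ ↔ E₀ x ∈ Z'.map N'.mkQ := by
    intro x
    constructor
    · rintro ⟨b, hb, rfl⟩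
      exact ⟨e b, (hZ b).1 hb, (hE₀ b).symm⟩
    · rintro ⟨b, hb, hx⟩
      refine ⟨e.symm b, (hZ _).2 (by rwa [e.apply_symm_apply]), E₀.injective ?_⟩
      rw [hE₀, e.apply_symm_apply, hx]
  refine ⟨⟨⟨fun x => ⟨E₀ x.1, (hmem _).1 x.2⟩, fun x => ⟨E₀.symm x.1, (hmem _).2 (by
    rw [E₀.apply_symm_apply]; exact x.2)⟩, fun x => Subtype.ext (E₀.symm_apply_apply _),
    fun x => Subtype.ext (E₀.apply_symm_apply _)⟩, fun x y => Subtype.ext (map_add E₀ _ _)⟩, ?_⟩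
  rintro s ⟨x, b, hb, rfl⟩
  exact Subtype.ext (congrArg N'.mkQ (he s b))

lemma nonempty_subquotient_linearEquiv {R B B' : Type} [Ring R] [AddCommGroup B] [Module R B]
    [AddCommGroup B'] [Module R B'] {Z N : Submodule R B} {Z' N' : Submodule R B'}
    (e : B ≃ₗ[R] B') (hZ : ∀ b, b ∈ Z ↔ e b ∈ Z') (hN : ∀ b, b ∈ N ↔ e b ∈ N') :
    Nonempty (↥(Z.map N.mkQ) ≃ₗ[R] ↥(Z'.map N'.mkQ)) := by
  obtain ⟨E, hE⟩ := exists_subquotient_addEquiv (RingHom.id R) e.toAddEquiv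
    (fun s b => map_smul e s b) hZ hN
  exact ⟨E.toLinearEquiv hE⟩

/-- The homology of a short complex of modules, as a subquotient. -/
def moduleCatHomologyEquiv {R : Type} [Ring R] (S : ShortComplex (ModuleCat.{0} R)) :
    S.homology ≃ₗ[R] ↥((LinearMap.ker S.g.hom).map (LinearMap.range S.f.hom).mkQ) :=
  S.moduleCatHomologyIso.toLinearEquiv ≪≫ₗ
    (Submodule.quotEquivOfEq _ _ (by
      ext x
      rw [LinearMap.mem_ker, LinearMap.comp_apply, Submodule.mkQ_apply,
        Submodule.Quotient.mk_eq_zero]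
      exact ⟨fun ⟨y, hy⟩ => ⟨y, congrArg Subtype.val hy⟩, fun ⟨y, hy⟩ => ⟨y, Subtype.ext hy⟩⟩) ≪≫ₗ
    LinearMap.quotKerEquivRange
      ((LinearMap.range S.f.hom).mkQ ∘ₗ (LinearMap.ker S.g.hom).subtype)) ≪≫ₗ
    LinearEquiv.ofEq _ _ (by rw [LinearMap.range_comp, Submodule.range_subtype])

/-- The homology of a complex of modules, as a subquotient. -/
def homologyEquivSubquotient {R ι : Type} [Ring R] {c : ComplexShape ι}
    (X : HomologicalComplex (ModuleCat.{0} R) c) {i j l : ι} (hi : c.prev j = i)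
    (hl : c.next j = l) :
    X.homology j ≃ₗ[R]
      ↥((LinearMap.ker (X.d j l).hom).map (LinearMap.range (X.d i j).hom).mkQ) :=
  (ShortComplex.homologyMapIso (X.isoSc' i j l hi hl)).toLinearEquiv ≪≫ₗ
    moduleCatHomologyEquiv (X.sc' i j l)

/-! ### Group homology with coefficients in a character -/

/-- The rank one representation given by a character. -/
abbrev charRep {R G : Type} [CommRing R] [Group G] (χ : G →* Rˣ) : Rep.{0} R G :=
  Rep.of (((Algebra.lmul R R : R →* Module.End R R).comp (Units.coeHom R)).comp χ)

lemma charRep_apply {R G : Type} [CommRing R] [Group G] (χ : G →* Rˣ) (g : G) (r : R) :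
    (charRep χ).ρ g r = (χ g : R) * r := rfl

section CliqueHomology

variable {n : ℕ} (Γ : SimpleGraph (Fin n)) {A : Type} [Ring A]

/-- The differential of the Koszul-type complex leaving degree `q` (zero for `q = 0`). -/
def cliqueDpre (a : Fin n → A) : ∀ q, (CliqueOfCard Γ q →₀ A) →ₗ[A] (CliqueOfCard Γ (q - 1) →₀ A)
  | 0 => 0
  | (q + 1) => cliqueD Γ a q

/-- The homology of the Koszul-type complex on cliques with coefficients `a`. -/
abbrev CliqueHomology (a : Fin n → A) (q : ℕ) : Type :=
  ↥((LinearMap.ker (cliqueDpre Γ a q)).map (LinearMap.range (cliqueD Γ a q)).mkQ)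

end CliqueHomology

lemma chainComplex_next_eq (q : ℕ) : (ComplexShape.down ℕ).next q = q - 1 := by
  cases q <;> simp

lemma cochainComplex_prev_eq (q : ℕ) : (ComplexShape.up ℕ).prev q = q - 1 := by
  cases q <;> simp

section

variable {R : Type} [CommRing R] {n : ℕ} (Γ : SimpleGraph (Fin n)) (χ : RAAG Γ →* Rˣ)

/-- Evaluation of the inverse character on the group algebra, multiplied by `r`. -/
def charEval (r : R) : MonoidAlgebra R (RAAG Γ) →+ R :=
  (AddMonoidHom.mulRight r).comp
    (MonoidAlgebra.lift R R (RAAG Γ) ((Units.coeHom R).comp χ⁻¹) : _ →+ R)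

lemma charEval_single (r s : R) (g : RAAG Γ) :
    charEval Γ χ r (MonoidAlgebra.single g s) = s * (χ g⁻¹ : R) * r := by
  simp [charEval]

/-- The coinvariants of the tensor product of a character with a free representation. -/
def charTensorFreeEquiv (α : Type) :
    ((Rep.coinvariantsTensor R (RAAG Γ)).obj (charRep χ)).obj (Rep.free R (RAAG Γ) α) ≃ₗ[R]
      (α →₀ R) :=
  Rep.coinvariantsTensorFreeLEquiv (charRep χ) α

/-- The class of the tensor `r ⊗ z` in the coinvariants. -/
def charTensorMk (α : Type) (r : R) : (α →₀ MonoidAlgebra R (RAAG Γ)) →+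
    ((Rep.coinvariantsTensor R (RAAG Γ)).obj (charRep χ)).obj (Rep.free R (RAAG Γ) α) :=
  (Rep.coinvariantsTensorMk (charRep χ) (Rep.free R (RAAG Γ) α) r).toAddMonoidHom

lemma charTensorFreeEquiv_mk (α : Type) (r : R) (z : α →₀ MonoidAlgebra R (RAAG Γ)) :
    charTensorFreeEquiv Γ χ α (charTensorMk Γ χ α r z) =
      Finsupp.mapRange.addMonoidHom (charEval Γ χ r) z := by
  induction z using Finsupp.induction_linear with
  | zero => simp only [map_zero]
  | add y z hy hz => simp only [map_add, hy, hz]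
  | single σ b =>
    induction b using MonoidAlgebra.induction_linear with
    | zero => simp only [Finsupp.single_zero, map_zero]
    | add y z hy hz => simp only [Finsupp.single_add, map_add, hy, hz]
    | single h s =>
      refine (Rep.coinvariantsTensorFreeToFinsupp_mk_tmul_single (charRep χ) r σ h s).trans ?_
      rw [Finsupp.mapRange.addMonoidHom_apply, Finsupp.mapRange_single, charEval_single,
        charRep_apply, smul_eq_mul, mul_assoc]

lemma charTensorFreeEquiv_symm_single (α : Type) (σ : α) (r : R) :
    (charTensorFreeEquiv Γ χ α).symm (Finsupp.single σ r) =
      charTensorMk Γ χ α r (Finsupp.single σ (MonoidAlgebra.single 1 1)) :=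
  Rep.finsuppToCoinvariantsTensorFree_single (A := charRep χ) σ r

lemma coinvariantsTensor_map_mk (q : ℕ) (r : R)
    (z : CliqueOfCard Γ (q + 1) →₀ MonoidAlgebra R (RAAG Γ)) :
    (((Rep.coinvariantsTensor R (RAAG Γ)).obj (charRep χ)).map (cliqueRepD R Γ q)).hom
        (charTensorMk Γ χ _ r z) =
      charTensorMk Γ χ _ r (cliqueD Γ (raagDiff R Γ) q z) :=
  congrArg (charTensorMk Γ χ (CliqueOfCard Γ q) r) (cliqueRepD_apply R Γ q z)

lemma charTensorFreeEquiv_map (q : ℕ)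
    (x : ((Rep.coinvariantsTensor R (RAAG Γ)).obj (charRep χ)).obj
      (Rep.free R (RAAG Γ) (CliqueOfCard Γ (q + 1)))) :
    charTensorFreeEquiv Γ χ (CliqueOfCard Γ q)
      ((((Rep.coinvariantsTensor R (RAAG Γ)).obj (charRep χ)).map (cliqueRepD R Γ q)).hom x) =
    cliqueD Γ (fun i => (χ (PresentedGroup.of i)⁻¹ : R) - 1) q
      (charTensorFreeEquiv Γ χ (CliqueOfCard Γ (q + 1)) x) := by
  obtain ⟨y, rfl⟩ := (charTensorFreeEquiv Γ χ (CliqueOfCard Γ (q + 1))).symm.surjective x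
  rw [LinearEquiv.apply_symm_apply]
  induction y using Finsupp.induction_linear with
  | zero => simp only [map_zero]
  | add y z hy hz => simp only [map_add, hy, hz]
  | single σ r =>
    rw [charTensorFreeEquiv_symm_single, coinvariantsTensor_map_mk, charTensorFreeEquiv_mk,
      cliqueD_single, cliqueD_single, map_cliqueBoundary]
    congr 1
    ext1 i
    rw [← MonoidAlgebra.one_def, one_mul, raagDiff, map_sub, MonoidAlgebra.of_apply,
      MonoidAlgebra.one_def, charEval_single, charEval_single]
    simp
    ring

end

/-- The homology of a chain complex of modules, computed from an isomorphic explicit complex. -/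
lemma chainComplex_homology_equiv {R : Type} [Ring R] (X : ChainComplex (ModuleCat.{0} R) ℕ)
    {C : ℕ → Type} [∀ q, AddCommGroup (C q)] [∀ q, Module R (C q)] (e : ∀ q, X.X q ≃ₗ[R] C q)
    (D : ∀ q, C (q + 1) →ₗ[R] C q) (Dpre : ∀ q, C q →ₗ[R] C (q - 1)) (h0 : Dpre 0 = 0)
    (hD : ∀ q, Dpre (q + 1) = D q) (he : ∀ q x, e q ((X.d (q + 1) q).hom x) = D q (e (q + 1) x))
    (q : ℕ) :
    Nonempty (X.homology q ≃ₗ[R]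
      ↥((LinearMap.ker (Dpre q)).map (LinearMap.range (D q)).mkQ)) := by
  obtain ⟨E⟩ := nonempty_subquotient_linearEquiv (e q)
    (Z := LinearMap.ker (X.d q (q - 1)).hom) (N := LinearMap.range (X.d (q + 1) q).hom)
    (Z' := LinearMap.ker (Dpre q)) (N' := LinearMap.range (D q))
    (by
      intro b
      cases q with
      | zero =>
        rw [X.shape _ _ (by simp), h0]
        exact iff_of_true rfl rfl
      | succ q =>
        rw [LinearMap.mem_ker, LinearMap.mem_ker, hD, ← he]
        exact (LinearEquiv.map_eq_zero_iff _).symm)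
    (by
      intro b
      constructor
      · rintro ⟨x, rfl⟩
        exact ⟨_, (he q x).symm⟩
      · rintro ⟨y, hy⟩
        refine ⟨(e _).symm y, (e q).injective ?_⟩
        rw [← hy, he, LinearEquiv.apply_symm_apply])
  exact ⟨homologyEquivSubquotient _ (ChainComplex.prev _ q) (chainComplex_next_eq q) ≪≫ₗ E⟩

lemma cliqueResolution_d (R : Type) [CommRing R] {n : ℕ} (Γ : SimpleGraph (Fin n)) (q : ℕ) :
    (cliqueResolution R Γ).complex.d (q + 1) q = cliqueRepD R Γ q :=
  chainComplex_of_d (fun q => Rep.free R (RAAG Γ) (CliqueOfCard Γ q)) (cliqueRepD R Γ)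
    (cliqueRepD_comp R Γ) q

/-- The terms of the complex computing the group homology from the clique resolution. -/
def cliqueCoinvariantsEquiv {R : Type} [CommRing R] {n : ℕ} (Γ : SimpleGraph (Fin n))
    (χ : RAAG Γ →* Rˣ) (q : ℕ) :
    ((cliqueResolution R Γ).complex.coinvariantsTensorObj (charRep χ)).X q ≃ₗ[R]
      (CliqueOfCard Γ q →₀ R) :=
  charTensorFreeEquiv Γ χ (CliqueOfCard Γ q)

lemma cliqueCoinvariants_d {R : Type} [CommRing R] {n : ℕ} (Γ : SimpleGraph (Fin n))
    (χ : RAAG Γ →* Rˣ) (q : ℕ) :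
    ((cliqueResolution R Γ).complex.coinvariantsTensorObj (charRep χ)).d (q + 1) q =
      ((Rep.coinvariantsTensor R (RAAG Γ)).obj (charRep χ)).map (cliqueRepD R Γ q) :=
  congrArg (((Rep.coinvariantsTensor R (RAAG Γ)).obj (charRep χ)).map ·) (cliqueResolution_d R Γ q)

lemma cliqueCoinvariantsEquiv_d {R : Type} [CommRing R] {n : ℕ} (Γ : SimpleGraph (Fin n))
    (χ : RAAG Γ →* Rˣ) (q : ℕ)
    (x : ((cliqueResolution R Γ).complex.coinvariantsTensorObj (charRep χ)).X (q + 1)) :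
    cliqueCoinvariantsEquiv Γ χ q
      ((((cliqueResolution R Γ).complex.coinvariantsTensorObj (charRep χ)).d (q + 1) q).hom x) =
    cliqueD Γ (fun i => (χ (PresentedGroup.of i)⁻¹ : R) - 1) q
      (cliqueCoinvariantsEquiv Γ χ (q + 1) x) := by
  have h := charTensorFreeEquiv_map Γ χ q x
  have h2 : (((cliqueResolution R Γ).complex.coinvariantsTensorObj (charRep χ)).d (q + 1) q).hom x
      = (((Rep.coinvariantsTensor R (RAAG Γ)).obj (charRep χ)).map (cliqueRepD R Γ q)).hom x :=
    congrArg (fun g => g.hom x) (cliqueCoinvariants_d Γ χ q)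
  exact (congrArg (cliqueCoinvariantsEquiv Γ χ q) h2).trans h

lemma groupHomology_charRep_equiv {R : Type} [CommRing R] {n : ℕ} (Γ : SimpleGraph (Fin n))
    (χ : RAAG Γ →* Rˣ) (q : ℕ) :
    Nonempty (groupHomology (charRep χ) q ≃ₗ[R]
      CliqueHomology Γ (fun i => (χ (PresentedGroup.of i)⁻¹ : R) - 1) q) := by
  obtain ⟨e⟩ := chainComplex_homology_equiv
    ((cliqueResolution R Γ).complex.coinvariantsTensorObj (charRep χ))
    (cliqueCoinvariantsEquiv Γ χ)
    (cliqueD Γ (fun i => (χ (PresentedGroup.of i)⁻¹ : R) - 1))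
    (cliqueDpre Γ (fun i => (χ (PresentedGroup.of i)⁻¹ : R) - 1)) rfl (fun _ => rfl)
    (cliqueCoinvariantsEquiv_d Γ χ) q
  exact ⟨(groupHomologyIso (charRep χ) q (cliqueResolution R Γ)).toLinearEquiv ≪≫ₗ e⟩

/-! ### Group homology with coefficients in the Laurent ring -/

/-- The character of `G` on the Laurent ring induced by `φ : G → ℤᵐ`. -/
def laurentChar (k : Type) [Field k] {m : ℕ} {G : Type} [Group G]
    (φ : G →* Multiplicative (Fin m → ℤ)) : G →* (LaurentRing k m)ˣ :=
  ((AddMonoidAlgebra.of k (Fin m → ℤ)).comp φ).toHomUnits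

lemma laurentChar_apply (k : Type) [Field k] {m : ℕ} {G : Type} [Group G]
    (φ : G →* Multiplicative (Fin m → ℤ)) (g : G) :
    (laurentChar k φ g : LaurentRing k m) =
      AddMonoidAlgebra.single (Multiplicative.toAdd (φ g)) 1 := rfl

lemma inhomogD_single (k : Type) [Field k] {m : ℕ} {G : Type} [Group G]
    (φ : G →* Multiplicative (Fin m → ℤ)) (q : ℕ) (g : Fin (q + 1) → G) (r : LaurentRing k m) :
    inhomogD k φ q (Finsupp.single g r) =
      Finsupp.single (fun i => g i.succ) ((laurentChar k φ (g 0)⁻¹ : LaurentRing k m) * r) +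
      ∑ j : Fin (q + 1), (-1 : LaurentRing k m) ^ ((j : ℕ) + 1) •
        Finsupp.single (Fin.contractNth j (· * ·) g) r := by
  rw [inhomogD, Finsupp.lsum_single, LinearMap.add_apply, LinearMap.sum_apply]
  congr 1
  · rw [laurentChar_apply, map_inv, toAdd_inv]
    rfl
  · refine Finset.sum_congr rfl fun j _ => ?_
    rw [LinearMap.smul_apply, Finsupp.lsingle_apply, ← Int.cast_smul_eq_zsmul (LaurentRing k m)]
    push_cast
    rfl

lemma groupHomologyLaurent_equiv (k : Type) [Field k] {m : ℕ} {G : Type} [Group G]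
    (φ : G →* Multiplicative (Fin m → ℤ)) (q : ℕ) :
    Nonempty (groupHomologyLaurent k φ q ≃ₗ[LaurentRing k m]
      groupHomology (charRep (laurentChar k φ)) q) := by
  have hd : ∀ q, ((groupHomology.inhomogeneousChains.d (charRep (laurentChar k φ)) q).hom :
      ((Fin (q + 1) → G) →₀ LaurentRing k m) →ₗ[LaurentRing k m] _) = inhomogD k φ q := by
    intro q
    refine Finsupp.lhom_ext fun g r => ?_
    rw [inhomogD_single]
    exact groupHomology.inhomogeneousChains.d_single (A := charRep (laurentChar k φ)) q g r
  obtain ⟨e⟩ := chainComplex_homology_equiv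
    (groupHomology.inhomogeneousChains (charRep (laurentChar k φ)))
    (C := fun q => inhomogChains k m G q)
    (fun q => LinearEquiv.refl _ _) (inhomogD k φ) (inhomogDpre k φ) rfl (fun _ => rfl)
    (fun q x => by
      have h := groupHomology.inhomogeneousChains.d_def (charRep (laurentChar k φ)) q
      exact (congrArg (fun g => g.hom x) h).trans (congrArg (fun g => g x) (hd q))) q
  exact ⟨e.symm⟩

lemma groupHomologyLaurent_raag_equiv (k : Type) [Field k] {m n : ℕ} (Γ : SimpleGraph (Fin n))
    (f : Fin n → Fin m) (φ : RAAG Γ →* Multiplicative (Fin m → ℤ))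
    (hφ : ∀ i, φ (PresentedGroup.of i) = Multiplicative.ofAdd (Pi.single (f i) 1)) (q : ℕ) :
    Nonempty (groupHomologyLaurent k φ q ≃ₗ[LaurentRing k m]
      CliqueHomology Γ (fun i => (AddMonoidAlgebra.single (-Pi.single (f i) 1) 1 - 1 :
        LaurentRing k m)) q) := by
  obtain ⟨e⟩ := groupHomologyLaurent_equiv k φ q
  obtain ⟨e'⟩ := groupHomology_charRep_equiv Γ (laurentChar k φ) q
  have h : (fun i => (laurentChar k φ (PresentedGroup.of i)⁻¹ : LaurentRing k m) - 1) =
      fun i => AddMonoidAlgebra.single (-Pi.single (f i) 1) 1 - 1 := by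
    ext1 i
    rw [laurentChar_apply, map_inv, hφ]
    rfl
  rw [← h]
  exact ⟨e.trans e'⟩

/-! ### Rescaling the coefficients by units -/

section Rescale

variable {R : Type} [CommRing R] {n : ℕ} (Γ : SimpleGraph (Fin n)) (u : Fin n → Rˣ)

/-- Multiplication of the coefficient at a clique by the product of the units at its vertices. -/
def cliqueRescale (q : ℕ) : (CliqueOfCard Γ q →₀ R) ≃ₗ[R] (CliqueOfCard Γ q →₀ R) :=
  Finsupp.linearEquivFunOnFinite R R (CliqueOfCard Γ q) ≪≫ₗ
    LinearEquiv.piCongrRight (fun σ => LinearEquiv.smulOfUnit (∏ i ∈ σ.1, u i)) ≪≫ₗ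
    (Finsupp.linearEquivFunOnFinite R R (CliqueOfCard Γ q)).symm

lemma cliqueRescale_single (q : ℕ) (σ : CliqueOfCard Γ q) (r : R) :
    cliqueRescale Γ u q (Finsupp.single σ r) =
      Finsupp.single σ (((∏ i ∈ σ.1, u i : Rˣ) : R) * r) := by
  ext τ
  change ((∏ i ∈ τ.1, u i : Rˣ) : R) * Finsupp.single σ r τ = _
  rw [Finsupp.single_apply, Finsupp.single_apply]
  split_ifs with h
  · rw [h]
  · rw [mul_zero]

lemma cliqueRescale_cliqueD (a : Fin n → R) (q : ℕ) (z : CliqueOfCard Γ (q + 1) →₀ R) :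
    cliqueRescale Γ u q (cliqueD Γ (fun i => u i * a i) q z) =
      cliqueD Γ a q (cliqueRescale Γ u (q + 1) z) := by
  induction z using Finsupp.induction_linear with
  | zero => simp only [map_zero]
  | add y z hy hz => simp only [map_add, hy, hz]
  | single σ r =>
    rw [cliqueRescale_single, cliqueD_single, cliqueD_single, cliqueBoundary, cliqueBoundary,
      map_sum]
    refine Finset.sum_congr rfl fun i _ => ?_
    split_ifs with h
    · rw [cliqueRescale_single, ← Finset.mul_prod_erase _ _ h, mul_smul_comm]
      congr 2
      push_cast
      simp only [CliqueOfCard.erase]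
      ring
    · rw [map_zero]

lemma cliqueHomology_rescale (a : Fin n → R) (q : ℕ) :
    Nonempty (CliqueHomology Γ (fun i => u i * a i) q ≃ₗ[R] CliqueHomology Γ a q) := by
  refine nonempty_subquotient_linearEquiv (cliqueRescale Γ u q) (fun b => ?_) fun b => ?_
  · cases q with
    | zero => exact iff_of_true rfl rfl
    | succ q =>
      rw [LinearMap.mem_ker, LinearMap.mem_ker, cliqueDpre, cliqueDpre, ← cliqueRescale_cliqueD]
      exact (LinearEquiv.map_eq_zero_iff _).symm
  · constructor
    · rintro ⟨x, rfl⟩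
      exact ⟨_, (cliqueRescale_cliqueD Γ u a q x).symm⟩
    · rintro ⟨y, hy⟩
      refine ⟨(cliqueRescale Γ u (q + 1)).symm y, (cliqueRescale Γ u q).injective ?_⟩
      rw [cliqueRescale_cliqueD, LinearEquiv.apply_symm_apply, hy]

end Rescale

lemma phiS_X (k : Type) [Field k] {n m : ℕ} (f : Fin n → Fin m) (i : Fin n) :
    phiS k f (MvPolynomial.X i) = AddMonoidAlgebra.single (Pi.single (f i) 1) 1 - 1 :=
  MvPolynomial.eval₂Hom_X' _ _ _

lemma groupHomologyLaurent_equiv_cliqueHomology (k : Type) [Field k] {m n : ℕ}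
    (Γ : SimpleGraph (Fin n)) (f : Fin n → Fin m) (φ : RAAG Γ →* Multiplicative (Fin m → ℤ))
    (hφ : ∀ i, φ (PresentedGroup.of i) = Multiplicative.ofAdd (Pi.single (f i) 1)) (q : ℕ) :
    Nonempty (groupHomologyLaurent k φ q ≃ₗ[LaurentRing k m]
      CliqueHomology Γ (fun i => phiS k f (MvPolynomial.X i)) q) := by
  obtain ⟨e⟩ := groupHomologyLaurent_raag_equiv k Γ f φ hφ q
  have h : (fun i => (AddMonoidAlgebra.single (-Pi.single (f i) 1) 1 - 1 : LaurentRing k m)) =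
      fun i => ((-laurentChar k φ (PresentedGroup.of i)⁻¹ : (LaurentRing k m)ˣ) :
        LaurentRing k m) * phiS k f (MvPolynomial.X i) := by
    ext1 i
    rw [Units.val_neg, laurentChar_apply, map_inv, hφ, phiS_X, ← ofAdd_neg, toAdd_ofAdd, neg_mul,
      mul_sub, AddMonoidAlgebra.single_mul_single, neg_add_cancel, mul_one, mul_one,
      ← AddMonoidAlgebra.one_def, neg_sub]
  rw [h] at e
  obtain ⟨e'⟩ := cliqueHomology_rescale Γ
    (fun i => -laurentChar k φ (PresentedGroup.of i)⁻¹) (fun i => phiS k f (MvPolynomial.X i)) q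
  exact ⟨e.trans e'⟩

/-! ### The Cartan complex of a clique complex -/

section Cartan

variable {k : Type} [Field k] {n : ℕ} {Γ : SimpleGraph (Fin n)}

lemma cartanD_apply (p : ℕ) (y : cartanTerm k (cliqueComplex Γ) p)
    (J : CliqueOfCard Γ (p + 1)) :
    cartanD k (cliqueComplex Γ) p y J = ∑ i, if h : i ∈ J.1 then
      insertSign (J.1.erase i) i • (MvPolynomial.X i * y (J.erase i h)) else 0 := by
  rw [cartanD, LinearMap.pi_apply, LinearMap.sum_apply]
  refine Finset.sum_congr rfl fun i _ => ?_
  by_cases h : i ∈ J.1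
  · have hs : (J.1.erase i).filter (· < i) = J.1.filter (· < i) := by
      rw [Finset.filter_erase]
      exact Finset.erase_eq_of_notMem (by simp)
    rw [dif_pos h, dif_pos ⟨h, cliqueComplex_mono J.2.1 (Finset.erase_subset _ _)⟩, insertSign, hs]
    rfl
  · rw [dif_neg h, dif_neg fun h' => h h'.1, LinearMap.zero_apply]

lemma cartanD_apply_eq_linearCombination (p : ℕ) (y : cartanTerm k (cliqueComplex Γ) p)
    (J : CliqueOfCard Γ (p + 1)) :
    cartanD k (cliqueComplex Γ) p y J = Finsupp.linearCombination (polyRing k n) y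
      (cliqueD Γ MvPolynomial.X p (Finsupp.single J 1)) := by
  rw [cartanD_apply, cliqueD_single, cliqueBoundary, map_sum]
  refine Finset.sum_congr rfl fun i _ => ?_
  split_ifs
  · rw [Finsupp.linearCombination_single, one_mul, smul_assoc, smul_eq_mul]
  · rw [map_zero]

lemma linearCombination_cartanD (p : ℕ) (y : cartanTerm k (cliqueComplex Γ) p)
    (z : CliqueOfCard Γ (p + 1) →₀ polyRing k n) :
    Finsupp.linearCombination (polyRing k n) (cartanD k (cliqueComplex Γ) p y) z =
      Finsupp.linearCombination (polyRing k n) y (cliqueD Γ MvPolynomial.X p z) := by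
  induction z using Finsupp.induction_linear with
  | zero => simp only [map_zero]
  | add y z hy hz => simp only [map_add, hy, hz]
  | single J s =>
    rw [Finsupp.linearCombination_single, cartanD_apply_eq_linearCombination, ← map_smul,
      ← map_smul, Finsupp.smul_single, smul_eq_mul, mul_one]

lemma cartanD_cartanD (p : ℕ) (y : cartanTerm k (cliqueComplex Γ) p) :
    cartanD k (cliqueComplex Γ) (p + 1) (cartanD k (cliqueComplex Γ) p y) = 0 := by
  ext1 J
  rw [cartanD_apply_eq_linearCombination, linearCombination_cartanD,
    cliqueD_cliqueD _ fun i j _ => Commute.all _ _, map_zero, Pi.zero_apply]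

lemma mem_range_of_subsingleton_cartanCohomology {p : ℕ}
    (h : Subsingleton (cartanCohomology k (cliqueComplex Γ) p))
    {z : cartanTerm k (cliqueComplex Γ) p} (hz : cartanD k (cliqueComplex Γ) p z = 0) :
    z ∈ LinearMap.range (cartanDpre k (cliqueComplex Γ) p) := by
  have h' := @Subsingleton.elim _ h
    ⟨(LinearMap.range (cartanDpre k (cliqueComplex Γ) p)).mkQ z, z, hz, rfl⟩ 0
  exact (Submodule.Quotient.mk_eq_zero _).1 (congrArg Subtype.val h')

lemma constantCoeff_cartanDpre {p : ℕ} (y : cartanTerm k (cliqueComplex Γ) (p - 1))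
    (J : CliqueOfCard Γ p) :
    MvPolynomial.constantCoeff (cartanDpre k (cliqueComplex Γ) p y J) = 0 := by
  cases p with
  | zero => exact map_zero _
  | succ p =>
    rw [cartanDpre, cartanD_apply, map_sum]
    refine Finset.sum_eq_zero fun i _ => ?_
    split_ifs
    · rw [map_zsmul, map_mul, MvPolynomial.constantCoeff_X, zero_mul, smul_zero]
    · exact map_zero _

/-- If the Cartan complex has cohomology only in degree `N`, then no clique has more than `N`
vertices. -/
lemma card_le_of_cartan_concentrated {N : ℕ}
    (hvanish : ∀ p : ℕ, p ≠ N → Subsingleton (cartanCohomology k (cliqueComplex Γ) p))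
    {σ : Finset (Fin n)} (hσ : σ ∈ cliqueComplex Γ) : σ.card ≤ N := by
  obtain ⟨τ, hτ, hmax⟩ := Finset.exists_max_image
    (Finset.univ.filter (· ∈ cliqueComplex Γ)) Finset.card ⟨σ, by simp [hσ]⟩
  refine (hmax σ (by simp [hσ])).trans ?_
  by_contra! hN
  have hτ' : τ ∈ cliqueComplex Γ := (Finset.mem_filter.1 hτ).2
  obtain ⟨y, hy⟩ := mem_range_of_subsingleton_cartanCohomology (hvanish τ.card hN.ne')
    (z := Pi.single ⟨τ, hτ', rfl⟩ 1) (funext fun J => by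
      have := hmax J.1 (by simp [J.2.1])
      have := J.2.2
      omega)
  have h := constantCoeff_cartanDpre y (⟨τ, hτ', rfl⟩ : CliqueOfCard Γ τ.card)
  rw [hy, Pi.single_eq_same, map_one] at h
  exact one_ne_zero h

end Cartan

/-! ### The resolution of the top cohomology of the Cartan complex -/

/-- The cliques of `Γ` with `N - r` vertices, for `r ≤ N`. -/
abbrev CliqueOfCocard {n : ℕ} (Γ : SimpleGraph (Fin n)) (N r : ℕ) : Type :=
  {σ : Finset (Fin n) // σ ∈ cliqueComplex Γ ∧ σ.card + r = N}

section Resolution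

variable {k : Type} [Field k] {n : ℕ} {Γ : SimpleGraph (Fin n)} {N : ℕ}

/-- The face of a clique obtained by removing the vertex `i`. -/
def CliqueOfCocard.erase {r : ℕ} (σ : CliqueOfCocard Γ N r) (i : Fin n) (h : i ∈ σ.1) :
    CliqueOfCocard Γ N (r + 1) :=
  ⟨σ.1.erase i, cliqueComplex_mono σ.2.1 (Finset.erase_subset _ _), by
    have := σ.2.2
    have := Finset.card_erase_add_one h
    omega⟩

/-- Cliques indexed by the number of vertices and by its complement in `N`. -/
def cliqueReindex (Γ : SimpleGraph (Fin n)) {q r : ℕ} (h : q + r = N) :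
    CliqueOfCard Γ q ≃ CliqueOfCocard Γ N r :=
  Equiv.subtypeEquivRight fun σ => and_congr_right fun _ => by omega

lemma cliqueReindex_erase {q r : ℕ} (h : q + (r + 1) = N) (h' : q + 1 + r = N)
    (σ : CliqueOfCard Γ (q + 1)) (i : Fin n) (hi : i ∈ σ.1) :
    cliqueReindex Γ h (σ.erase i hi) = (cliqueReindex Γ h' σ).erase i hi := rfl

lemma isEmpty_cliqueOfCocard {r : ℕ} (h : N < r) : IsEmpty (CliqueOfCocard Γ N r) :=
  ⟨fun σ => by have := σ.2.2; omega⟩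

variable (k Γ N) in
/-- The Cartan differential, indexed by the distance to the top degree `N`. -/
def cartanCoD (r : ℕ) : (CliqueOfCocard Γ N (r + 1) → polyRing k n) →ₗ[polyRing k n]
    (CliqueOfCocard Γ N r → polyRing k n) :=
  LinearMap.pi fun J => ∑ i, if h : i ∈ J.1 then
    insertSign (J.1.erase i) i • ((LinearMap.mulLeft (polyRing k n) (MvPolynomial.X i)).comp
      (LinearMap.proj (J.erase i h))) else 0

lemma cartanCoD_apply (r : ℕ) (y : CliqueOfCocard Γ N (r + 1) → polyRing k n)
    (J : CliqueOfCocard Γ N r) :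
    cartanCoD k Γ N r y J = ∑ i, if h : i ∈ J.1 then
      insertSign (J.1.erase i) i • (MvPolynomial.X i * y (J.erase i h)) else 0 := by
  rw [cartanCoD, LinearMap.pi_apply, LinearMap.sum_apply]
  refine Finset.sum_congr rfl fun i _ => ?_
  split_ifs <;> rfl

lemma cartanCoD_reindex {p r : ℕ} (h : p + (r + 1) = N) (h' : p + 1 + r = N)
    (y : CliqueOfCocard Γ N (r + 1) → polyRing k n) :
    cartanCoD k Γ N r y ∘ cliqueReindex Γ h' =
      cartanD k (cliqueComplex Γ) p (y ∘ cliqueReindex Γ h) := by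
  ext1 J
  rw [cartanD_apply, Function.comp_apply, cartanCoD_apply]
  rfl

lemma cartanCoD_cartanCoD (r : ℕ) (y : CliqueOfCocard Γ N (r + 1 + 1) → polyRing k n) :
    cartanCoD k Γ N r (cartanCoD k Γ N (r + 1) y) = 0 := by
  rcases lt_or_ge N (r + 1 + 1) with h | h
  · have := isEmpty_cliqueOfCocard (Γ := Γ) h
    rw [Subsingleton.elim y 0, map_zero, map_zero]
  · obtain ⟨p, hp⟩ := Nat.exists_eq_add_of_le' h
    apply (cliqueReindex Γ (show p + 1 + 1 + r = N by omega)).surjective.injective_comp_right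
    change _ ∘ _ = _ ∘ _
    rw [cartanCoD_reindex (show p + 1 + (r + 1) = N by omega),
      cartanCoD_reindex (show p + (r + 1 + 1) = N by omega), cartanD_cartanD]
    rfl

lemma cartanCoD_exact
    (hvanish : ∀ p : ℕ, p ≠ N → Subsingleton (cartanCohomology k (cliqueComplex Γ) p)) (r : ℕ)
    (x : CliqueOfCocard Γ N (r + 1) → polyRing k n) (hx : cartanCoD k Γ N r x = 0) :
    ∃ y, cartanCoD k Γ N (r + 1) y = x := by
  rcases lt_or_ge N (r + 1) with h | h
  · have := isEmpty_cliqueOfCocard (Γ := Γ) h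
    exact ⟨0, Subsingleton.elim _ _⟩
  · obtain ⟨p, hp⟩ := Nat.exists_eq_add_of_le' h
    obtain ⟨y, hy⟩ := mem_range_of_subsingleton_cartanCohomology (hvanish p (by omega))
      (z := x ∘ cliqueReindex Γ hp.symm) (by
        rw [← cartanCoD_reindex hp.symm (show p + 1 + r = N by omega), hx]
        rfl)
    cases p with
    | zero =>
      refine ⟨0, (cliqueReindex Γ hp.symm).surjective.injective_comp_right ?_⟩
      change _ ∘ _ = _ ∘ _
      rw [map_zero, ← hy]
      rfl
    | succ p =>
      have h' : p + (r + 1 + 1) = N := by omega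
      refine ⟨y ∘ (cliqueReindex Γ h').symm,
        (cliqueReindex Γ hp.symm).surjective.injective_comp_right ?_⟩
      change _ ∘ _ = _ ∘ _
      rw [cartanCoD_reindex h', Function.comp_assoc, Equiv.symm_comp_self, Function.comp_id]
      exact hy

lemma cartanD_top
    (hvanish : ∀ p : ℕ, p ≠ N → Subsingleton (cartanCohomology k (cliqueComplex Γ) p))
    (z : cartanTerm k (cliqueComplex Γ) N) : cartanD k (cliqueComplex Γ) N z = 0 :=
  funext fun J => by
    have := card_le_of_cartan_concentrated hvanish J.2.1
    have := J.2.2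
    omega

variable (hvanish : ∀ p : ℕ, p ≠ N → Subsingleton (cartanCohomology k (cliqueComplex Γ) p))

/-- The projection onto the top cohomology of the Cartan complex. -/
def cartanAug : (CliqueOfCocard Γ N 0 → polyRing k n) →ₗ[polyRing k n]
    cartanCohomology k (cliqueComplex Γ) N :=
  LinearMap.codRestrict _ ((LinearMap.range (cartanDpre k (cliqueComplex Γ) N)).mkQ ∘ₗ
    LinearMap.funLeft (polyRing k n) (polyRing k n) (cliqueReindex Γ (Nat.add_zero N)))
    fun _ => ⟨_, cartanD_top hvanish _, rfl⟩

lemma cartanAug_surjective : Function.Surjective (cartanAug hvanish) := by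
  rintro ⟨_, z, -, rfl⟩
  refine ⟨z ∘ (cliqueReindex Γ (Nat.add_zero N)).symm, Subtype.ext ?_⟩
  exact congrArg (LinearMap.range (cartanDpre k (cliqueComplex Γ) N)).mkQ
    (funext fun J => congrArg z (Equiv.symm_apply_apply _ J))

lemma cartanAug_eq_zero_iff (x : CliqueOfCocard Γ N 0 → polyRing k n) :
    cartanAug hvanish x = 0 ↔ x ∘ cliqueReindex Γ (Nat.add_zero N) ∈
      LinearMap.range (cartanDpre k (cliqueComplex Γ) N) :=
  Subtype.ext_iff.trans (Submodule.Quotient.mk_eq_zero _)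

lemma cartanAug_cartanCoD (y : CliqueOfCocard Γ N (0 + 1) → polyRing k n) :
    cartanAug hvanish (cartanCoD k Γ N 0 y) = 0 := by
  rw [cartanAug_eq_zero_iff]
  cases N with
  | zero =>
    have := isEmpty_cliqueOfCocard (Γ := Γ) (show 0 < 0 + 1 by omega)
    rw [Subsingleton.elim y 0, map_zero]
    exact zero_mem _
  | succ N =>
    rw [cartanCoD_reindex rfl]
    exact ⟨_, rfl⟩

lemma cartanAug_exact (x : CliqueOfCocard Γ N 0 → polyRing k n) (hx : cartanAug hvanish x = 0) :
    ∃ y, cartanCoD k Γ N 0 y = x := by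
  obtain ⟨y, hy⟩ := (cartanAug_eq_zero_iff hvanish x).1 hx
  cases N with
  | zero =>
    refine ⟨0, (cliqueReindex Γ (Nat.add_zero 0)).surjective.injective_comp_right ?_⟩
    change _ ∘ _ = _ ∘ _
    rw [map_zero, ← hy]
    rfl
  | succ N =>
    have h' : N + (0 + 1) = N + 1 := rfl
    refine ⟨y ∘ (cliqueReindex Γ h').symm,
      (cliqueReindex Γ (Nat.add_zero (N + 1))).surjective.injective_comp_right ?_⟩
    change _ ∘ _ = _ ∘ _
    rw [cartanCoD_reindex h', Function.comp_assoc, Equiv.symm_comp_self, Function.comp_id]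
    exact hy

/-- The projective resolution of the top cohomology given by the Cartan complex. -/
def cartanResolution : ProjectiveResolution
    (ModuleCat.of (polyRing k n) (cartanCohomology k (cliqueComplex Γ) N)) :=
  projectiveResolutionOfExact
    (fun r => ModuleCat.of (polyRing k n) (CliqueOfCocard Γ N r → polyRing k n))
    (fun r => ModuleCat.ofHom (cartanCoD k Γ N r))
    (fun r => ModuleCat.hom_ext (LinearMap.ext (cartanCoD_cartanCoD r)))
    (ModuleCat.ofHom (cartanAug hvanish))
    (ModuleCat.hom_ext (LinearMap.ext (cartanAug_cartanCoD hvanish)))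
    (fun _ => inferInstance)
    ((ModuleCat.epi_iff_surjective _).2 (cartanAug_surjective hvanish))
    ((ShortComplex.moduleCat_exact_iff _).2 (cartanAug_exact hvanish))
    (fun r => (ShortComplex.moduleCat_exact_iff _).2 (cartanCoD_exact hvanish r))

end Resolution

/-! ### Computation of `Ext` from the Cartan complex -/

section ExtCartan

variable {k : Type} [Field k] {n m : ℕ} {Γ : SimpleGraph (Fin n)} {N : ℕ} (f : Fin n → Fin m)

/-- Chains on cliques with Laurent coefficients as homomorphisms out of the Cartan complex. -/
def cliqueCochainEquiv {q r : ℕ} (h : q + r = N) : (CliqueOfCard Γ q →₀ LaurentRing k m) ≃+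
    ((CliqueOfCocard Γ N r → polyRing k n) →ₗ[polyRing k n] laurentAsSModule k f) :=
  ((Finsupp.linearEquivFunOnFinite (LaurentRing k m) (LaurentRing k m) (CliqueOfCard Γ q) ≪≫ₗ
    LinearEquiv.funCongrLeft (LaurentRing k m) (LaurentRing k m)
      (cliqueReindex Γ h).symm).toAddEquiv).trans
  ((Pi.basisFun (polyRing k n) (CliqueOfCocard Γ N r)).constr (M' := laurentAsSModule k f)
    (polyRing k n)).toAddEquiv

lemma cliqueCochainEquiv_single {q r : ℕ} (h : q + r = N)
    (z : CliqueOfCard Γ q →₀ LaurentRing k m) (σ : CliqueOfCard Γ q) :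
    cliqueCochainEquiv f h z (Pi.single (cliqueReindex Γ h σ) 1) = z σ := by
  rw [← Pi.basisFun_apply]
  refine ((Pi.basisFun (polyRing k n) (CliqueOfCocard Γ N r)).constr_basis
    (M' := laurentAsSModule k f) (polyRing k n) _ _).trans ?_
  exact congrArg z (Equiv.symm_apply_apply _ σ)

lemma cliqueCochainEquiv_apply {q r : ℕ} (h : q + r = N) (J : CliqueOfCard Γ q)
    (b : LaurentRing k m) (y : CliqueOfCocard Γ N r → polyRing k n) :
    cliqueCochainEquiv f h (Finsupp.single J b) y =
      (show laurentAsSModule k f from phiS k f (y (cliqueReindex Γ h J)) * b) := by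
  conv_lhs => rw [← (Pi.basisFun (polyRing k n) (CliqueOfCocard Γ N r)).sum_repr y]
  rw [map_sum, Finset.sum_eq_single (cliqueReindex Γ h J)]
  · rw [map_smul, Pi.basisFun_apply, cliqueCochainEquiv_single, Finsupp.single_eq_same]
    rfl
  · intro σ _ hσ
    obtain ⟨σ, rfl⟩ := (cliqueReindex Γ h).surjective σ
    rw [map_smul, Pi.basisFun_apply, cliqueCochainEquiv_single,
      Finsupp.single_eq_of_ne fun h' => hσ (congrArg _ h')]
    exact mul_zero (phiS k f _)
  · exact fun h' => (h' (Finset.mem_univ _)).elim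

lemma cliqueCochainEquiv_smul {q r : ℕ} (h : q + r = N) (s : polyRing k n)
    (z : CliqueOfCard Γ q →₀ LaurentRing k m) :
    cliqueCochainEquiv f h (phiS k f s • z) = s • cliqueCochainEquiv f h z := by
  refine (Pi.basisFun (polyRing k n) (CliqueOfCocard Γ N r)).ext fun σ => ?_
  obtain ⟨σ, rfl⟩ := (cliqueReindex Γ h).surjective σ
  rw [LinearMap.smul_apply, Pi.basisFun_apply, cliqueCochainEquiv_single,
    cliqueCochainEquiv_single]
  rfl

lemma cliqueCochainEquiv_cliqueD {q r : ℕ} (h : q + 1 + r = N) (h' : q + (r + 1) = N)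
    (z : CliqueOfCard Γ (q + 1) →₀ LaurentRing k m) :
    cliqueCochainEquiv f h z ∘ₗ cartanCoD k Γ N r =
      cliqueCochainEquiv f h' (cliqueD Γ (fun i => phiS k f (MvPolynomial.X i)) q z) := by
  refine LinearMap.ext fun y => ?_
  induction z using Finsupp.induction_linear with
  | zero => simp only [map_zero, LinearMap.zero_comp]
  | add y z hy hz =>
    simp only [map_add, LinearMap.add_comp, LinearMap.add_apply] at hy hz ⊢
    rw [hy, hz]
  | single J b =>
    rw [LinearMap.comp_apply, cliqueCochainEquiv_apply, cliqueD_single, cliqueBoundary, map_sum,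
      LinearMap.sum_apply, cartanCoD_apply, map_sum, Finset.sum_mul]
    refine Finset.sum_congr rfl fun i _ => ?_
    by_cases hi : i ∈ J.1
    · rw [dif_pos hi, dif_pos (show i ∈ (cliqueReindex Γ h J).1 from hi),
        cliqueCochainEquiv_apply, cliqueReindex_erase h' h, map_zsmul, map_mul, smul_mul_assoc,
        mul_smul_comm]
      change _ • _ = _ • _
      congr 1
      ring
    · rw [dif_neg hi, dif_neg (show i ∉ (cliqueReindex Γ h J).1 from hi), map_zero, map_zero,
        zero_mul]
      rfl

variable
  (hvanish : ∀ p : ℕ, p ≠ N → Subsingleton (cartanCohomology k (cliqueComplex Γ) p))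

/-- The complex computing `Ext` from the Cartan complex. -/
abbrev cartanExtComplex : CochainComplex (ModuleCat.{0} (polyRing k n)) ℕ :=
  (cartanResolution hvanish).complex.linearYonedaObj (polyRing k n) (laurentAsSModule k f)

/-- Chains on cliques with Laurent coefficients as cochains computing `Ext`. -/
def cliqueExtEquiv {q r : ℕ} (h : q + r = N) :
    (CliqueOfCard Γ q →₀ LaurentRing k m) ≃+ (cartanExtComplex f hvanish).X r :=
  (cliqueCochainEquiv f h).trans (ModuleCat.homAddEquiv
    (M := ModuleCat.of (polyRing k n) (CliqueOfCocard Γ N r → polyRing k n))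
    (N := laurentAsSModule k f)).symm

lemma cliqueExtEquiv_smul {q r : ℕ} (h : q + r = N) (s : polyRing k n)
    (z : CliqueOfCard Γ q →₀ LaurentRing k m) :
    cliqueExtEquiv f hvanish h (phiS k f s • z) = s • cliqueExtEquiv f hvanish h z :=
  congrArg ModuleCat.ofHom (cliqueCochainEquiv_smul f h s z)

lemma cartanResolution_d (r : ℕ) :
    (cartanResolution hvanish).complex.d (r + 1) r = ModuleCat.ofHom (cartanCoD k Γ N r) :=
  chainComplex_of_d
    (fun r => ModuleCat.of (polyRing k n) (CliqueOfCocard Γ N r → polyRing k n))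
    (fun r => ModuleCat.ofHom (cartanCoD k Γ N r))
    (fun r => ModuleCat.hom_ext (LinearMap.ext (cartanCoD_cartanCoD r))) r

lemma cartanExtComplex_d (r : ℕ) (g : (cartanResolution hvanish).complex.X r ⟶
    laurentAsSModule k f) :
    ((cartanExtComplex f hvanish).d r (r + 1)).hom g =
      (cartanResolution hvanish).complex.d (r + 1) r ≫ g := rfl

lemma cliqueExtEquiv_cliqueD {q r : ℕ} (h : q + 1 + r = N) (h' : q + (r + 1) = N)
    (z : CliqueOfCard Γ (q + 1) →₀ LaurentRing k m) :
    ((cartanExtComplex f hvanish).d r (r + 1)).hom (cliqueExtEquiv f hvanish h z) =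
      cliqueExtEquiv f hvanish h' (cliqueD Γ (fun i => phiS k f (MvPolynomial.X i)) q z) := by
  refine (cartanExtComplex_d f hvanish r _).trans ?_
  rw [cartanResolution_d]
  exact congrArg ModuleCat.ofHom (cliqueCochainEquiv_cliqueD f h h' z)

lemma exists_cliqueHomology_addEquiv_ext
    (hvanish : ∀ p : ℕ, p ≠ N → Subsingleton (cartanCohomology k (cliqueComplex Γ) p))
    {q r : ℕ} (h : q + r = N) :
    ∃ e : CliqueHomology Γ (fun i => phiS k f (MvPolynomial.X i)) q ≃+
      ((Ext (polyRing k n) (ModuleCat (polyRing k n)) r).obj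
        (Opposite.op (ModuleCat.of (polyRing k n)
          (cartanCohomology k (cliqueComplex Γ) N)))).obj (laurentAsSModule k f),
      ∀ (s : polyRing k n) x, e (phiS k f s • x) = s • e x := by
  obtain ⟨E, hE⟩ := exists_subquotient_addEquiv (phiS k f)
    (Z := LinearMap.ker (cliqueDpre Γ (fun i => phiS k f (MvPolynomial.X i)) q))
    (N := LinearMap.range (cliqueD Γ (fun i => phiS k f (MvPolynomial.X i)) q))
    (Z' := LinearMap.ker ((cartanExtComplex f hvanish).d r (r + 1)).hom)
    (N' := LinearMap.range ((cartanExtComplex f hvanish).d (r - 1) r).hom)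
    (cliqueExtEquiv f hvanish h) (cliqueExtEquiv_smul f hvanish h)
    (by
      intro b
      cases q with
      | zero =>
        have := isEmpty_cliqueOfCocard (Γ := Γ) (show N < r + 1 by omega)
        refine iff_of_true rfl ?_
        refine (cartanExtComplex_d f hvanish r _).trans ?_
        refine ModuleCat.hom_ext (LinearMap.ext fun y => ?_)
        rw [show y = 0 from Subsingleton.elim (α := CliqueOfCocard Γ N (r + 1) → polyRing k n) _ _,
          map_zero, map_zero]
      | succ q =>
        have h' : q + (r + 1) = N := by omega
        rw [LinearMap.mem_ker, LinearMap.mem_ker, cliqueExtEquiv_cliqueD f hvanish h h']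
        exact (AddEquiv.map_eq_zero_iff _).symm)
    (by
      intro b
      cases r with
      | zero =>
        have : IsEmpty (CliqueOfCard Γ (q + 1)) := ⟨fun σ => by
          have := card_le_of_cartan_concentrated hvanish σ.2.1
          have := σ.2.2
          omega⟩
        rw [HomologicalComplex.shape _ _ _ (by simp)]
        constructor
        · rintro ⟨x, rfl⟩
          rw [Subsingleton.elim x 0, map_zero, map_zero]
          exact zero_mem _
        · rintro ⟨y, hy⟩
          rw [(AddEquiv.map_eq_zero_iff _).1 hy.symm]
          exact zero_mem _
      | succ r =>
        have h' : q + 1 + r = N := by omega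
        rw [Nat.add_sub_cancel]
        constructor
        · rintro ⟨x, rfl⟩
          exact ⟨_, cliqueExtEquiv_cliqueD f hvanish h' h x⟩
        · rintro ⟨y, hy⟩
          obtain ⟨x, rfl⟩ := (cliqueExtEquiv f hvanish h').surjective y
          rw [cliqueExtEquiv_cliqueD f hvanish h' h] at hy
          exact ⟨x, (cliqueExtEquiv f hvanish h).injective hy⟩)
  let e' := (homologyEquivSubquotient (cartanExtComplex f hvanish) (cochainComplex_prev_eq r)
    (CochainComplex.next ℕ r)).symm ≪≫ₗ
      ((cartanResolution hvanish).isoExt r (laurentAsSModule k f)).symm.toLinearEquiv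
  exact ⟨E.trans e'.toAddEquiv, fun s x => (congrArg e' (hE s x)).trans (map_smul e' _ _)⟩

end ExtCartan

lemma subsingleton_cliqueHomology {R : Type} [Ring R] {n : ℕ} {Γ : SimpleGraph (Fin n)}
    (a : Fin n → R) {q : ℕ} [IsEmpty (CliqueOfCard Γ q)] : Subsingleton (CliqueHomology Γ a q) :=
  ⟨by
    rintro ⟨_, x, -, rfl⟩ ⟨_, y, -, rfl⟩
    exact Subtype.ext (congrArg (LinearMap.range (cliqueD Γ a q)).mkQ (Subsingleton.elim x y))⟩

/-- Let `K` be the clique complex of `Γ`, suppose the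
Cartan complex of `K` has cohomology concentrated in degree `d + 1` (i.e.
`K` is Cohen–Macaulay of dimension `d`), and let `F_K` be that cohomology
module.  Then for every `q` there is an isomorphism of `S`-modules
`H_q(G_Γ; k[ℤᵐ]) ≅ Ext_S^{d+1-q}(F_K, k[ℤᵐ])`; in particular for `q > d+1`
(where the `Ext` index would be negative) the homology vanishes. -/
theorem groupHomology_iso_ext_of_cartan_concentrated {m : ℕ} {n : ℕ}
    (Γ : SimpleGraph (Fin n)) (d : ℕ)
    (hvanish : ∀ p : ℕ, p ≠ d + 1 →
      Subsingleton (cartanCohomology k (cliqueComplex Γ) p))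
    (f : Fin n → Fin m) (hf : Function.Surjective f)
    (φ : RAAG Γ →* Multiplicative (Fin m → ℤ))
    (hφ : ∀ i : Fin n, φ (PresentedGroup.of i) =
      Multiplicative.ofAdd (Pi.single (f i) 1)) :
    (∀ q : ℕ, q ≤ d + 1 →
      Nonempty
        (groupHomologyS k φ f q ≃ₗ[polyRing k n]
          ↥(((Ext (polyRing k n) (ModuleCat (polyRing k n)) (d + 1 - q)).obj
              (Opposite.op (ModuleCat.of (polyRing k n)
                (cartanCohomology k (cliqueComplex Γ) (d + 1))))).obj
            (laurentAsSModule k f)))) ∧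
    (∀ q : ℕ, d + 1 < q → Subsingleton (groupHomologyS k φ f q)) := by
  have hΓ := groupHomologyLaurent_equiv_cliqueHomology k Γ f φ hφ
  refine ⟨fun q hq => ?_, fun q hq => ?_⟩
  · obtain ⟨E⟩ := hΓ q
    obtain ⟨e, he⟩ := exists_cliqueHomology_addEquiv_ext f hvanish (Nat.add_sub_cancel' hq)
    have hs : ∀ (s : polyRing k n) (x : groupHomologyLaurent k φ q),
        e (E (phiS k f s • x)) = s • e (E x) := fun s x =>
      (congrArg e (map_smul E (phiS k f s) x)).trans (he s (E x))
    let e' : groupHomologyS k φ f q ≃+ _ := E.toAddEquiv.trans e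
    exact ⟨e'.toLinearEquiv hs⟩
  · obtain ⟨E⟩ := hΓ q
    have : IsEmpty (CliqueOfCard Γ q) := ⟨fun σ => by
      have := card_le_of_cartan_concentrated hvanish σ.2.1
      have := σ.2.2
      omega⟩
    have := subsingleton_cliqueHomology (Γ := Γ) (fun i => phiS k f (MvPolynomial.X i)) (q := q)
    exact E.toEquiv.subsingleton
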